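/- Let R be a commutative Noetherian ring of finite Krull dimension d ≥ 1 and let A be a reduced geometric subring of R[T]. Let M be a finitely generated torsion-free A-module such that, for some non-zero divisor g ∈ I_A, the localization M_g is a projective A_g-module of rank ≥ d + 1 at every prime of A_g. Let (f, m) ∈ A ⊕ M be a unimodular element such that (1) f − 1 ∈ gA and m ∈ gM, and (2) g + g²g' ∈ O_M(m) for some g' ∈ A. Then (A ⊕ M)/((f, m)A) ≅ M, and there exists an automorphism α of A ⊕ M sending (f, m) to (1, 0). Moreover, if M is projective, the same conclusions hold without hypothesis (2). -/

import Mathlib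

open Polynomial

set_option maxHeartbeats 1000000
set_option synthInstance.maxHeartbeats 400000

/-- `A` is a geometric subring of `R[T]`, where `d = dim R`. -/
def IsGeometricSubring {R : Type*} [CommRing R] (A : Subalgebra R (Polynomial R)) (d : ℕ) : Prop :=
  IsNoetherianRing A ∧
  (∃ s : R, s ∈ nonZeroDivisors R ∧ ∀ f : Polynomial R, ∃ k : ℕ, (C s) ^ k * f ∈ A) ∧
  ringKrullDim A = (d + 1 : ℕ)

/-- The ideal `I_A = { f ∈ A : f(0) = 0 }` of a subring `A` of `R[T]`. -/
noncomputable def idealIA {R : Type*} [CommRing R] (A : Subalgebra R (Polynomial R)) : Ideal A :=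
  RingHom.ker ((evalRingHom (0 : R)).comp A.val.toRingHom)

/-- The order ideal `O_M(m) = { f m : f ∈ Hom_R(M, R) }`. -/
def orderIdeal (R : Type*) [CommRing R] {M : Type*} [AddCommGroup M] [Module R M]
    (m : M) : Ideal R where
  carrier := Set.range fun f : M →ₗ[R] R => f m
  add_mem' := by rintro a b ⟨f, rfl⟩ ⟨g, rfl⟩; exact ⟨f + g, rfl⟩
  zero_mem' := ⟨0, rfl⟩
  smul_mem' := by rintro c a ⟨f, rfl⟩; exact ⟨c • f, rfl⟩

/-- The rank of the localization `M_p` at a prime `p`. -/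
noncomputable def rankAt {R : Type*} [CommRing R] (M : Type*) [AddCommGroup M] [Module R M]
    (p : Ideal R) (hp : p.IsPrime) : ℕ :=
  letI := hp
  Module.finrank (Localization p.primeCompl) (LocalizedModule p.primeCompl M)

/-- The vectors `u j`, reduced to the residue field at `p`. -/
noncomputable def residueVec {B ι κ : Type*} [CommRing B] (p : PrimeSpectrum B) (u : κ → ι → B) :
    κ → ι → p.asIdeal.ResidueField :=
  fun j i => algebraMap B p.asIdeal.ResidueField (u j i)

/-- The dimension of the span of a set of vectors at the residue field of `p`. -/
noncomputable def residueRank {B ι : Type*} [CommRing B] (p : PrimeSpectrum B)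
    (S : Set (ι → B)) : ℕ :=
  Module.finrank p.asIdeal.ResidueField
    (Submodule.span p.asIdeal.ResidueField (residueVec p id '' S))

theorem linearIndependent_residueVec_of_det_notMem {B ι : Type*} [CommRing B] [Fintype ι]
    (p : PrimeSpectrum B) {t : ℕ} (F : Fin t → ι → B) (u : Fin t → ι → B)
    (h : (Matrix.of fun i j => ∑ k, F i k * u j k).det ∉ p.asIdeal) :
    LinearIndependent p.asIdeal.ResidueField (residueVec p u) := by
  classical
  set K := p.asIdeal.ResidueField
  let L : (ι → K) →ₗ[K] (Fin t → K) :=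
    LinearMap.pi fun i => ∑ k, (algebraMap B K (F i k)) • LinearMap.proj k
  refine LinearIndependent.of_comp L ?_
  have h2 : (L ∘ residueVec p u) =
      ((Matrix.of fun i j => ∑ k, F i k * u j k).map (algebraMap B K)).col := by
    ext j i
    simp only [L, Matrix.col, K]
    simp [Algebra.smul_def]
    rfl
  rw [h2]
  apply Matrix.linearIndependent_cols_of_det_ne_zero
  rw [← RingHom.mapMatrix_apply, ← RingHom.map_det]
  rwa [Ne, Ideal.algebraMap_residueField_eq_zero]

theorem exists_det_notMem {B ι : Type*} [CommRing B] [Fintype ι]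
    (p : PrimeSpectrum B) {t : ℕ} (u : Fin t → ι → B)
    (h : LinearIndependent p.asIdeal.ResidueField (residueVec p u)) :
    ∃ F : Fin t → ι → B, (Matrix.of fun i j => ∑ k, F i k * u j k).det ∉ p.asIdeal := by
  classical
  set K := p.asIdeal.ResidueField with hK
  obtain ⟨L, hL⟩ := LinearMap.exists_leftInverse_of_injective
    (Fintype.linearCombination K (residueVec p u))
    (LinearMap.ker_eq_bot.2 (linearIndependent_iff_injective_fintypeLinearCombination.1 h))
  obtain ⟨e, he⟩ := IsLocalization.exist_integer_multiples_of_finite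
    (nonZeroDivisors (B ⧸ p.asIdeal)) (fun ik : Fin t × ι => L (Pi.single ik.2 1) ik.1)
  choose F hF using he
  choose F' hF' using fun ik => Ideal.Quotient.mk_surjective (F ik)
  refine ⟨fun i k => F' (i, k), ?_⟩
  set ε : K := algebraMap (B ⧸ p.asIdeal) K e with hε
  have hε0 : ε ≠ 0 := IsLocalization.to_map_ne_zero_of_mem_nonZeroDivisors K le_rfl e.2
  have hF'' : ∀ i k, algebraMap B K (F' (i, k)) = ε * L (Pi.single k 1) i := by
    intro i k
    rw [IsScalarTower.algebraMap_apply B (B ⧸ p.asIdeal) K]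
    have := hF (i, k)
    rw [← hF', Algebra.smul_def] at this
    exact this
  have key : (Matrix.of fun i j => ∑ k, F' (i, k) * u j k).map (algebraMap B K) = ε • 1 := by
    ext i j
    have h1 : L (residueVec p u j) = Pi.single j 1 := by
      have := LinearMap.congr_fun hL (Pi.single j 1)
      simpa [Fintype.linearCombination_apply_single] using this
    have h2 : residueVec p u j = ∑ k, algebraMap B K (u j k) • Pi.single k (1 : K) := by
      ext k
      simp only [residueVec, Finset.sum_apply, Pi.smul_apply, Pi.single_apply, smul_eq_mul, mul_ite,
        mul_one, mul_zero, Finset.sum_ite_eq, Finset.mem_univ, if_true]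
      rfl
    have h3 : ∑ k, algebraMap B K (u j k) * L (Pi.single k 1) i = (Pi.single j 1 : Fin t → K) i := by
      rw [← h1, h2, map_sum, Finset.sum_apply]
      exact Finset.sum_congr rfl fun k _ => by rw [map_smul]; rfl
    simp only [Matrix.map_apply, Matrix.of_apply, map_sum, map_mul, hF'', Matrix.smul_apply,
      Matrix.one_apply, smul_eq_mul]
    rw [Pi.single_apply] at h3
    rw [← h3, Finset.mul_sum]
    exact Finset.sum_congr rfl fun k _ => by ring
  intro hmem
  rw [← Ideal.algebraMap_residueField_eq_zero, RingHom.map_det, RingHom.mapMatrix_apply] at hmem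
  rw [key, Matrix.det_smul, Matrix.det_one, mul_one] at hmem
  exact pow_ne_zero _ hε0 hmem

theorem le_residueRank_iff {B ι : Type*} [CommRing B] [Fintype ι] (p : PrimeSpectrum B)
    (S : Set (ι → B)) (t : ℕ) :
    t ≤ residueRank p S ↔ ∃ (F u : Fin t → ι → B), (∀ i, u i ∈ S) ∧
      (Matrix.of fun i j => ∑ k, F i k * u j k).det ∉ p.asIdeal := by
  constructor
  · intro h
    obtain ⟨v, hvS, -, hv⟩ := Submodule.exists_fun_fin_finrank_span_eq p.asIdeal.ResidueField
      (residueVec p id '' S)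
    choose w hwS hwv using hvS
    have hlin : LinearIndependent p.asIdeal.ResidueField
        (residueVec p fun i : Fin t => w (Fin.castLE h i)) := by
      have h2 : (residueVec p fun i : Fin t => w (Fin.castLE h i)) = v ∘ Fin.castLE h :=
        funext fun i => hwv _
      rw [h2]
      exact hv.comp (Fin.castLE h) (Fin.castLE_injective h)
    obtain ⟨F, hF⟩ := exists_det_notMem p _ hlin
    exact ⟨F, _, fun i => hwS _, hF⟩
  · rintro ⟨F, u, huS, hF⟩
    have hlin := linearIndependent_residueVec_of_det_notMem p F u hF
    have h1 := finrank_span_eq_card hlin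
    rw [Fintype.card_fin] at h1
    rw [← h1]
    apply Submodule.finrank_mono
    apply Submodule.span_mono
    rintro _ ⟨j, rfl⟩
    exact ⟨u j, huS j, rfl⟩

/-- The residue rank is at most `t` exactly at the primes containing a certain ideal. -/
theorem exists_ideal_residueRank_le_iff {B ι : Type*} [CommRing B] [Fintype ι]
    (S : Set (ι → B)) (t : ℕ) :
    ∃ J : Ideal B, ∀ p : PrimeSpectrum B, residueRank p S ≤ t ↔ J ≤ p.asIdeal := by
  refine ⟨Ideal.span {a | ∃ (F u : Fin (t + 1) → ι → B), (∀ i, u i ∈ S) ∧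
      (Matrix.of fun i j => ∑ k, F i k * u j k).det = a}, fun p => ?_⟩
  rw [← not_lt, ← Nat.succ_le_iff, le_residueRank_iff, Ideal.span_le]
  constructor
  · rintro h a ⟨F, u, hu, rfl⟩
    by_contra hc
    exact h ⟨F, u, hu, hc⟩
  · rintro h ⟨F, u, hu, hc⟩
    exact hc (h ⟨F, u, hu, rfl⟩)

theorem residueVec_add_smul {B ι κ : Type*} [CommRing B] (p : PrimeSpectrum B)
    (u : κ → ι → B) (b : κ → B) (l : ι → B) :
    residueVec p (fun i => u i + b i • l) = fun i => residueVec p u i +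
      algebraMap B p.asIdeal.ResidueField (b i) • residueVec p id l := by
  ext i k
  simp only [residueVec, Pi.add_apply, Pi.smul_apply, smul_eq_mul, map_add, map_mul, id]

theorem residueRank_le_add_one {B ι κ : Type*} [CommRing B] [Finite ι] (p : PrimeSpectrum B)
    (u : κ → ι → B) (b : κ → B) (l : ι → B) :
    residueRank p (insert l (Set.range u)) ≤
      residueRank p (Set.range fun i => u i + b i • l) + 1 := by
  unfold residueRank
  set K := p.asIdeal.ResidueField
  have h1 : Submodule.span K (residueVec p id '' insert l (Set.range u)) ≤
      Submodule.span K (residueVec p id '' Set.range fun i => u i + b i • l) ⊔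
        Submodule.span K {residueVec p id l} := by
    rw [Submodule.span_le]
    rintro _ ⟨x, hx | ⟨i, rfl⟩, rfl⟩
    · rw [hx]
      exact Submodule.mem_sup_right (Submodule.mem_span_singleton_self _)
    · have : residueVec p id (u i) = residueVec p id (u i + b i • l) -
          algebraMap B K (b i) • residueVec p id l := by
        have := congrFun (residueVec_add_smul p u b l) i
        change residueVec p id (u i + b i • l) = residueVec p id (u i) + _ at this
        rw [this]
        simp [K]
      rw [this]
      apply Submodule.sub_mem
      · exact Submodule.mem_sup_left (Submodule.subset_span ⟨_, ⟨i, rfl⟩, rfl⟩)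
      · exact Submodule.mem_sup_right
          (Submodule.smul_mem _ _ (Submodule.mem_span_singleton_self _))
  calc _ ≤ _ := Submodule.finrank_mono h1
    _ ≤ _ := Submodule.finrank_add_le_finrank_add_finrank _ _
    _ ≤ _ := by
      gcongr
      exact (finrank_span_le_card _).trans (by simp)

theorem residueRank_insert_add_smul {B ι κ : Type*} [CommRing B] [Finite ι] (p : PrimeSpectrum B)
    (u : κ → ι → B) (b : κ → B) (l : ι → B) :
    residueRank p (insert l (Set.range u)) ≤
      residueRank p (insert l (Set.range fun i => u i + b i • l)) := by
  unfold residueRank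
  set K := p.asIdeal.ResidueField
  apply Submodule.finrank_mono
  rw [Submodule.span_le]
  have hl : residueVec p id l ∈ Submodule.span K
      (residueVec p id '' insert l (Set.range fun i => u i + b i • l)) :=
    Submodule.subset_span ⟨l, Set.mem_insert _ _, rfl⟩
  rintro _ ⟨x, hx | ⟨i, rfl⟩, rfl⟩
  · rw [hx]
    exact hl
  · have : residueVec p id (u i) = residueVec p id (u i + b i • l) -
        algebraMap B K (b i) • residueVec p id l := by
      have := congrFun (residueVec_add_smul p u b l) i
      change residueVec p id (u i + b i • l) = residueVec p id (u i) + _ at this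
      rw [this]
      simp [K]
    rw [this]
    exact Submodule.sub_mem _ (Submodule.subset_span ⟨_, Set.mem_insert_of_mem _ ⟨i, rfl⟩, rfl⟩)
      (Submodule.smul_mem _ _ hl)

/-- A linearly dependent family has a member in the span of the others; it can be chosen different
from the member `0` if that one does not vanish. -/
theorem exists_mem_span_others {K V : Type*} [Field K] [AddCommGroup V] [Module K V] {n : ℕ}
    (v : Fin (n + 1) → V) (hv : ¬ LinearIndependent K v) (P : Prop) (h0 : P ∨ v 0 ≠ 0) :
    ∃ i, (i = 0 → P) ∧ v i ∈ Submodule.span K (v '' {i}ᶜ) := by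
  rw [Fintype.not_linearIndependent_iff] at hv
  obtain ⟨c, hc, i, hi⟩ := hv
  have key : ∀ i, c i ≠ 0 → v i ∈ Submodule.span K (v '' {i}ᶜ) := by
    intro i hi
    rw [← Finset.add_sum_erase _ _ (Finset.mem_univ i)] at hc
    have : v i = -((c i)⁻¹ • ∑ j ∈ Finset.univ.erase i, c j • v j) := by
      rw [← smul_neg, eq_inv_smul_iff₀ hi, eq_neg_iff_add_eq_zero]
      exact hc
    rw [this]
    refine Submodule.neg_mem _ (Submodule.smul_mem _ _ (Submodule.sum_mem _ fun j hj => ?_))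
    exact Submodule.smul_mem _ _ (Submodule.subset_span ⟨j, by simpa using hj, rfl⟩)
  by_cases hP : P
  · exact ⟨i, fun _ => hP, key i hi⟩
  · have h0' := h0.resolve_left hP
    by_cases hex : ∃ j, j ≠ 0 ∧ c j ≠ 0
    · obtain ⟨j, hj0, hj⟩ := hex
      exact ⟨j, fun h => absurd h hj0, key j hj⟩
    · push Not at hex
      exfalso
      rw [Finset.sum_eq_single 0 (fun j _ hj => by rw [hex j hj, zero_smul]) (by simp)] at hc
      have h1 : c 0 = 0 := (smul_eq_zero.1 hc).resolve_right h0'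
      by_cases hi0 : i = 0
      · exact hi (hi0 ▸ h1)
      · exact hi (hex i hi0)

theorem exists_shift_residueRank {B ι : Type*} [CommRing B] [Finite ι] (p : PrimeSpectrum B)
    {n : ℕ} (f : B) (u : Fin (n + 1) → ι → B) (l : ι → B)
    (h : residueRank p (insert l (Set.range u)) ≤ n + 1)
    (h0 : f ∉ p.asIdeal ∨ residueVec p u 0 ≠ 0) :
    ∃ ε : Fin (n + 1) → B, ε 0 ∈ Ideal.span {f} ∧ ∀ r ∉ p.asIdeal,
      residueRank p (insert l (Set.range u)) ≤
        residueRank p (Set.range fun i => u i + (r * ε i) • l) := by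
  classical
  set K := p.asIdeal.ResidueField with hK
  by_cases hl : residueVec p id l ∈ Submodule.span K (Set.range (residueVec p u))
  · refine ⟨0, by simp, fun r _ => ?_⟩
    simp only [Pi.zero_apply, mul_zero, zero_smul, add_zero]
    apply Submodule.finrank_mono
    rw [Submodule.span_le]
    have h3 : Set.range (residueVec p u) = residueVec p id '' Set.range u := by
      rw [← Set.range_comp]
      rfl
    rw [Set.image_insert_eq, Set.insert_subset_iff, ← h3]
    exact ⟨hl, Submodule.subset_span⟩
  · have hdep : ¬ LinearIndependent K (residueVec p u) := by
      intro hind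
      have h2 := (linearIndependent_finCons (x := residueVec p id l)).2 ⟨hind, hl⟩
      have h3 := finrank_span_eq_card h2
      rw [Fintype.card_fin, Fin.range_cons] at h3
      unfold residueRank at h
      rw [Set.image_insert_eq] at h
      have h4 : Set.range (residueVec p u) = residueVec p id '' Set.range u := by
        rw [← Set.range_comp]
        rfl
      rw [← h4] at h
      exact absurd (h3.symm.trans_le h) (by omega)
    obtain ⟨i, hi0, hi⟩ := exists_mem_span_others (residueVec p u) hdep (f ∉ p.asIdeal) h0
    refine ⟨Pi.single i (if i = 0 then f else 1), ?_, fun r hr => ?_⟩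
    · by_cases h : i = 0
      · subst h
        simp
      · rw [Pi.single_eq_of_ne (Ne.symm h)]
        exact Ideal.zero_mem _
    · set ε : Fin (n + 1) → B := Pi.single i (if i = 0 then f else 1) with hε
      apply Submodule.finrank_mono
      set W := Submodule.span K (residueVec p id '' Set.range fun j => u j + (r * ε j) • l)
      have hW : ∀ j, residueVec p u j + algebraMap B K (r * ε j) • residueVec p id l ∈ W := by
        intro j
        rw [← congrFun (residueVec_add_smul p u (fun j => r * ε j) l) j]
        exact Submodule.subset_span ⟨_, ⟨j, rfl⟩, rfl⟩
      have hne : ∀ j, j ≠ i → residueVec p u j ∈ W := by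
        intro j hj
        have := hW j
        rwa [hε, Pi.single_eq_of_ne hj, mul_zero, map_zero, zero_smul, add_zero] at this
      have hiW : residueVec p u i ∈ W := by
        refine Submodule.span_le.2 ?_ hi
        rintro _ ⟨j, hj, rfl⟩
        exact hne j hj
      have hlW : residueVec p id l ∈ W := by
        have h5 := (Submodule.add_mem_iff_right _ hiW).1 (hW i)
        refine (Submodule.smul_mem_iff _ ?_).1 h5
        rw [Ne, Ideal.algebraMap_residueField_eq_zero]
        intro hmem
        rcases p.2.mem_or_mem hmem with h | h
        · exact hr h
        · rw [hε, Pi.single_eq_same] at h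
          by_cases hh : i = 0
          · rw [if_pos hh] at h
            exact hi0 hh h
          · rw [if_neg hh] at h
            exact p.2.ne_top ((Ideal.eq_top_iff_one _).2 h)
      rw [Submodule.span_le]
      rintro _ ⟨x, hx | ⟨j, rfl⟩, rfl⟩
      · rw [hx]
        exact hlW
      · by_cases hj : j = i
        · subst hj
          exact hiW
        · exact hne j hj

theorem residueRank_insert_add_smul_eq {B ι κ : Type*} [CommRing B] [Finite ι]
    (p : PrimeSpectrum B) (u : κ → ι → B) (b : κ → B) (l : ι → B) :
    residueRank p (insert l (Set.range fun i => u i + b i • l)) =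
      residueRank p (insert l (Set.range u)) := by
  apply le_antisymm _ (residueRank_insert_add_smul p u b l)
  have := residueRank_insert_add_smul p (fun i => u i + b i • l) (-b) l
  simpa using this

theorem residueRank_range_congr {B ι κ : Type*} [CommRing B] (p : PrimeSpectrum B)
    {u u' : κ → ι → B} (h : residueVec p u = residueVec p u') :
    residueRank p (Set.range u) = residueRank p (Set.range u') := by
  have h5 : ∀ w : κ → ι → B, residueVec p id '' Set.range w = Set.range (residueVec p w) :=
    fun w => (Set.range_comp _ _).symm
  unfold residueRank
  rw [h5, h5, h]

theorem exists_shift_residueRank_finset {B ι : Type*} [CommRing B] [Finite ι] {n : ℕ} (f : B)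
    (u : Fin (n + 1) → ι → B) (l : ι → B) (S : Finset (PrimeSpectrum B))
    (h : ∀ p ∈ S, residueRank p (insert l (Set.range u)) ≤ n + 1)
    (h0 : ∀ p ∈ S, f ∉ p.asIdeal ∨ residueVec p u 0 ≠ 0) :
    ∃ b : Fin (n + 1) → B, b 0 ∈ Ideal.span {f} ∧ ∀ p ∈ S,
      residueRank p (insert l (Set.range u)) ≤ residueRank p (Set.range fun i => u i + b i • l) := by
  classical
  induction hk : S.card generalizing S with
  | zero =>
    rw [Finset.card_eq_zero] at hk
    subst hk
    exact ⟨0, by simp, by simp⟩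
  | succ k ih =>
    have hne : S.Nonempty := Finset.card_pos.1 (by omega)
    obtain ⟨p, hp⟩ := S.exists_minimal hne
    obtain ⟨b, hb0, hb⟩ := ih (S.erase p) (fun q hq => h q (Finset.mem_of_mem_erase hq))
      (fun q hq => h0 q (Finset.mem_of_mem_erase hq)) (by rw [Finset.card_erase_of_mem hp.1]; omega)
    obtain ⟨r, hrS, hrp⟩ : ∃ r, (∀ q ∈ S.erase p, r ∈ q.asIdeal) ∧ r ∉ p.asIdeal := by
      have : ¬ (S.erase p).inf PrimeSpectrum.asIdeal ≤ p.asIdeal := by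
        rw [p.2.inf_le']
        rintro ⟨q, hq, hqp⟩
        have hq' := Finset.mem_of_mem_erase hq
        exact Finset.ne_of_mem_erase hq (le_antisymm hqp (hp.2 hq' hqp))
      obtain ⟨r, hr, hrp⟩ := SetLike.not_le_iff_exists.1 this
      refine ⟨r, fun q hq => ?_, hrp⟩
      exact (Finset.inf_le (f := PrimeSpectrum.asIdeal) hq) hr
    set u' : Fin (n + 1) → ι → B := fun i => u i + b i • l with hu'
    have hrank : ∀ q, residueRank q (insert l (Set.range u')) =
      residueRank q (insert l (Set.range u)) := fun q => residueRank_insert_add_smul_eq q u b l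
    have h0' : f ∉ p.asIdeal ∨ residueVec p u' 0 ≠ 0 := by
      rcases h0 p hp.1 with h | h
      · exact Or.inl h
      · by_cases hf : f ∈ p.asIdeal
        · right
          have : algebraMap B p.asIdeal.ResidueField (b 0) = 0 :=
            Ideal.algebraMap_residueField_eq_zero.2
              ((Ideal.span_singleton_le_iff_mem _).2 hf hb0)
          rw [hu', residueVec_add_smul]
          simpa [this] using h
        · exact Or.inl hf
    obtain ⟨ε, hε0, hε⟩ := exists_shift_residueRank p f u' l ((hrank p).trans_le (h p hp.1)) h0'
    refine ⟨fun i => b i + r * ε i, Ideal.add_mem _ hb0 (Ideal.mul_mem_left _ _ hε0), ?_⟩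
    have hfun : (fun i => u i + (b i + r * ε i) • l) = fun i => u' i + (r * ε i) • l := by
      ext i
      simp only [hu', Pi.add_apply, Pi.smul_apply, smul_eq_mul]
      ring
    rw [hfun]
    intro q hq
    by_cases hqp : q = p
    · subst hqp
      rw [← hrank]
      exact hε r hrp
    · have hq' := Finset.mem_erase.2 ⟨hqp, hq⟩
      refine (hb q hq').trans (le_of_eq ?_)
      apply residueRank_range_congr
      rw [residueVec_add_smul q u' (fun i => r * ε i) l]
      ext i k
      have : algebraMap B q.asIdeal.ResidueField r = 0 :=
        Ideal.algebraMap_residueField_eq_zero.2 (hrS q hq')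
      simp [this]

theorem exists_shift_residueRank_generic {B ι : Type*} [CommRing B] [IsNoetherianRing B] [Finite ι]
    (X : Set (PrimeSpectrum B)) (hX : ∀ p ∈ X, ∀ q ≤ p, q ∈ X) (δ : PrimeSpectrum B → ℕ)
    (hδ : ∀ p ∈ X, ∀ q < p, δ p < δ q) {n : ℕ} (f : B) (u : Fin (n + 1) → ι → B) (l : ι → B)
    (h : ∀ p ∈ X, min (n + 2) (δ p + 1) ≤ residueRank p (insert l (Set.range u)))
    (h0 : ∀ p ∈ X, f ∉ p.asIdeal ∨ residueVec p u 0 ≠ 0) :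
    ∃ b : Fin (n + 1) → B, b 0 ∈ Ideal.span {f} ∧ ∀ p ∈ X,
      min (n + 1) (δ p + 1) ≤ residueRank p (Set.range fun i => u i + b i • l) := by
  classical
  have := Fintype.ofFinite ι
  have hfin : {p ∈ X | δ p + 1 ≤ n + 1 ∧
      residueRank p (insert l (Set.range u)) ≤ δ p + 1}.Finite := by
    have : {p ∈ X | δ p + 1 ≤ n + 1 ∧ residueRank p (insert l (Set.range u)) ≤ δ p + 1} ⊆
        ⋃ t ∈ Finset.range (n + 2), {p ∈ X | δ p + 1 = t ∧ t ≤ n + 1 ∧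
          residueRank p (insert l (Set.range u)) ≤ t} := by
      rintro p ⟨hp, h1, h2⟩
      simp only [Set.mem_iUnion]
      exact ⟨δ p + 1, by simp; omega, hp, rfl, h1, h2⟩
    refine Set.Finite.subset (Set.Finite.biUnion (Finset.finite_toSet _) fun t _ => ?_) this
    obtain ⟨J, hJ⟩ := exists_ideal_residueRank_le_iff (insert l (Set.range u)) t
    refine Set.Finite.of_finite_image ((J.finite_minimalPrimes_of_isNoetherianRing).subset ?_)
      (f := PrimeSpectrum.asIdeal) (fun _ _ _ _ h => PrimeSpectrum.ext h)
    rintro _ ⟨p, ⟨hp, h1, h2, h3⟩, rfl⟩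
    refine ⟨⟨p.2, (hJ p).1 h3⟩, ?_⟩
    rintro Q ⟨hQ, hJQ⟩ hQp
    by_contra hc
    have hlt : (⟨Q, hQ⟩ : PrimeSpectrum B) < p := lt_of_le_not_ge hQp hc
    have h4 := hδ p hp _ hlt
    have h5 := h _ (hX p hp _ hlt.le)
    have h6 := (hJ ⟨Q, hQ⟩).2 hJQ
    omega
  obtain ⟨b, hb0, hb⟩ := exists_shift_residueRank_finset f u l hfin.toFinset (by
    intro p hp
    rw [Set.Finite.mem_toFinset] at hp
    exact hp.2.2.trans hp.2.1) (by
    intro p hp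
    rw [Set.Finite.mem_toFinset] at hp
    exact h0 p hp.1)
  refine ⟨b, hb0, fun p hp => ?_⟩
  by_cases hbad : δ p + 1 ≤ n + 1 ∧ residueRank p (insert l (Set.range u)) ≤ δ p + 1
  · have h1 := hb p (by rw [Set.Finite.mem_toFinset]; exact ⟨hp, hbad⟩)
    have h2 := h p hp
    omega
  · have h1 := residueRank_le_add_one p u b l
    have h2 := h p hp
    omega

/-- A vector form of the Eisenbud–Evans theorem. -/
theorem eisenbudEvans_vector {B ι : Type*} [CommRing B] [IsNoetherianRing B] [Finite ι]
    (X : Set (PrimeSpectrum B)) (hX : ∀ p ∈ X, ∀ q ≤ p, q ∈ X) (δ : PrimeSpectrum B → ℕ)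
    (hδ : ∀ p ∈ X, ∀ q < p, δ p < δ q) (f : B) (n : ℕ) (v : ι → B) (w : Fin n → ι → B)
    (h : ∀ p ∈ X, min (n + 1) (δ p + 1) ≤ residueRank p (insert v (Set.range w)))
    (h0 : ∀ p ∈ X, f ∉ p.asIdeal ∨ residueVec p id v ≠ 0) :
    ∃ c : Fin n → B, ∀ p ∈ X, residueVec p id (v + f • ∑ j, c j • w j) ≠ 0 := by
  induction n generalizing v with
  | zero =>
    refine ⟨Fin.elim0, fun p hp => ?_⟩
    have h1 := h p hp
    simp only [Finset.univ_eq_empty, Finset.sum_empty, smul_zero, add_zero]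
    intro h2
    unfold residueRank at h1
    rw [Set.range_eq_empty, insert_empty_eq, Set.image_singleton, h2, Submodule.span_zero_singleton,
      finrank_bot] at h1
    omega
  | succ n ih =>
    set l := w (Fin.last n)
    set w' : Fin n → ι → B := fun j => w j.castSucc
    have hrange : insert l (Set.range (Fin.cons v w' : Fin (n + 1) → ι → B)) =
        insert v (Set.range w) := by
      have : w = Fin.snoc w' l := by
        ext j k
        refine Fin.lastCases ?_ (fun j => ?_) j
        · simp [l]
        · simp [w']
      rw [Fin.range_cons, this, Fin.range_snoc, Set.insert_comm]
    obtain ⟨b, hb0, hb⟩ := exists_shift_residueRank_generic X hX δ hδ f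
      (Fin.cons v w' : Fin (n + 1) → ι → B) l (by rw [hrange]; exact h) (by
        intro p hp
        exact h0 p hp)
    obtain ⟨a, ha⟩ := Ideal.mem_span_singleton'.1 hb0
    have hr : (Set.range fun i => (Fin.cons v w' : Fin (n + 1) → ι → B) i + b i • l) =
        insert (v + b 0 • l) (Set.range fun j => w' j + b j.succ • l) := by
      rw [← Fin.range_cons]
      congr 1
      ext i k
      refine Fin.cases ?_ (fun j => ?_) i <;> simp
    rw [hr] at hb
    obtain ⟨c, hc⟩ := ih (v + b 0 • l) (fun j => w' j + b j.succ • l) hb (by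
      intro p hp
      by_cases hf : f ∈ p.asIdeal
      · right
        have h1 := (h0 p hp).resolve_left (not_not.2 hf)
        have h2 : algebraMap B p.asIdeal.ResidueField (b 0) = 0 :=
          Ideal.algebraMap_residueField_eq_zero.2
            ((Ideal.span_singleton_le_iff_mem _).2 hf hb0)
        have h3 := congrFun (residueVec_add_smul p (fun _ : Unit => v) (fun _ => b 0) l) ()
        change residueVec p id (v + b 0 • l) = residueVec p id v + _ at h3
        rw [h3, h2, zero_smul, add_zero]
        exact h1
      · exact Or.inl hf)
    refine ⟨Fin.snoc c (a + ∑ j, c j * b j.succ), fun p hp => ?_⟩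
    have heq : v + f • ∑ j, (Fin.snoc c (a + ∑ j, c j * b j.succ) : Fin (n + 1) → B) j • w j =
        v + b 0 • l + f • ∑ j, c j • (w' j + b j.succ • l) := by
      rw [Fin.sum_univ_castSucc, ← ha]
      simp only [Fin.snoc_castSucc, Fin.snoc_last]
      simp only [smul_add, Finset.sum_add_distrib, add_smul, ← smul_smul]
      simp only [w', l, smul_smul, ← Finset.sum_smul, mul_comm a f]
      abel
    rw [heq]
    exact hc p hp

/-- Up to an element outside `P`, the submodule `W` of `M` contains `r` vectors of `M` that are
dual to `r` linear forms on `M`. -/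
def HasDualFamilyAt {A M : Type*} [CommRing A] [AddCommGroup M] [Module A M] (W : Submodule A M)
    (P : Ideal A) (r : ℕ) : Prop :=
  ∃ c ∉ P, ∃ (φ : Fin r → M →ₗ[A] A) (y : Fin r → M), (∀ j, y j ∈ W) ∧
    ∀ i j, φ i (y j) = if i = j then c else 0

theorem residueVec_mem_span {A B M ι κ : Type*} [CommRing A] [CommRing B] [Algebra A B]
    [AddCommGroup M] [Module A M] (ψ : ι → M →ₗ[A] A) (q : PrimeSpectrum B) (w : κ → M) {y : M}
    (hy : y ∈ Submodule.span A (Set.range w)) (S : Set (ι → B))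
    (hS : ∀ j, (fun i => algebraMap A B (ψ i (w j))) ∈ S) :
    residueVec q id (fun i => algebraMap A B (ψ i y)) ∈
      Submodule.span q.asIdeal.ResidueField (residueVec q id '' S) := by
  induction hy using Submodule.span_induction with
  | mem x hx =>
    obtain ⟨j, rfl⟩ := hx
    exact Submodule.subset_span ⟨_, hS j, rfl⟩
  | zero =>
    convert Submodule.zero_mem _
    ext i
    simp [residueVec]
  | add x y _ _ hx hy =>
    convert Submodule.add_mem _ hx hy using 1
    ext i
    simp [residueVec]
  | smul a x _ hx =>
    convert Submodule.smul_mem _ (algebraMap B q.asIdeal.ResidueField (algebraMap A B a)) hx using 1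
    ext i
    simp only [residueVec, map_smul, smul_eq_mul, map_mul, id, Pi.smul_apply]

/-- Eisenbud–Evans for a unimodular element `(f, m)`, modulo an ideal `I`. -/
theorem exists_orderIdeal_not_le {A M : Type*} [CommRing A] [IsNoetherianRing A]
    [AddCommGroup M] [Module A M] [Module.Finite A M] (I : Ideal A) (u : A) (d : ℕ) {n : ℕ}
    (w : Fin n → M) (f : A) (m : M)
    (h : ∀ P : Ideal A, P.IsPrime → I ≤ P → u ∉ P →
      HasDualFamilyAt (Submodule.span A (Set.range w)) P (d + 1))
    (hum : ∃ (a : A) (φ : M →ₗ[A] A), a * f + φ m = 1) :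
    ∃ x ∈ Submodule.span A (Set.range w), ∀ q : Ideal (A ⧸ I), q.IsPrime →
      Ideal.Quotient.mk I u ∉ q → q.height ≤ d →
        ∃ φ : M →ₗ[A] A, Ideal.Quotient.mk I (φ (m + f • x)) ∉ q := by
  classical
  obtain ⟨k, ψ, hψ⟩ := Module.Finite.exists_fin (R := A) (M := M →ₗ[A] A)
  set B := A ⧸ I
  set vec : M → Fin k → B := fun m i => algebraMap A B (ψ i m)
  have hψ' : ∀ φ : M →ₗ[A] A, ∃ a : Fin k → A, ∀ y, φ y = ∑ i, a i * ψ i y := by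
    intro φ
    have : φ ∈ Submodule.span A (Set.range ψ) := hψ ▸ Submodule.mem_top
    obtain ⟨a, ha⟩ := (Submodule.mem_span_range_iff_exists_fun A).1 this
    refine ⟨a, fun y => ?_⟩
    rw [← ha]
    simp
  let X : Set (PrimeSpectrum B) := {q | Ideal.Quotient.mk I u ∉ q.asIdeal ∧ q.asIdeal.height ≤ d}
  obtain ⟨c, hc⟩ := eisenbudEvans_vector (ι := Fin k) X
    (fun p hp q hq => ⟨fun hu => hp.1 (hq hu), (Ideal.height_mono hq).trans hp.2⟩)
    (fun q => d - q.asIdeal.height.toNat) (by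
      intro p hp q hq
      have h1 := Ideal.height_add_one_le_of_lt_of_isPrime (I := q.asIdeal) (J := p.asIdeal) hq
      have h2 := hp.2
      have h3 : p.asIdeal.height ≠ ⊤ := ne_top_of_le_ne_top (by simp) h2
      have h4 : q.asIdeal.height ≠ ⊤ := ne_top_of_le_ne_top h3 (le_self_add.trans h1)
      obtain ⟨a, ha⟩ := ENat.ne_top_iff_exists.1 h3
      obtain ⟨b, hb⟩ := ENat.ne_top_iff_exists.1 h4
      rw [← ha, ← hb] at h1
      rw [← ha] at h2
      rw [← ha, ← hb]
      simp only [ENat.toNat_natCast]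
      norm_cast at h1 h2
      omega) (algebraMap A B f) n (vec m) (fun j => vec (w j)) (by
      intro q hq
      obtain ⟨c, hc, φ, y, hy, hφy⟩ := h (q.asIdeal.comap (Ideal.Quotient.mk I))
        (Ideal.comap_isPrime _ _) (fun a ha => by
          rw [Ideal.mem_comap, Ideal.Quotient.eq_zero_iff_mem.2 ha]
          exact q.asIdeal.zero_mem) hq.1
      choose a ha using fun i => hψ' (φ i)
      have hlin := linearIndependent_residueVec_of_det_notMem q
        (fun i j => algebraMap A B (a i j)) (fun j => vec (y j)) (by
          have : (Matrix.of fun i j => ∑ k, algebraMap A B (a i k) * vec (y j) k) =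
              (algebraMap A B c) • (1 : Matrix (Fin (d + 1)) (Fin (d + 1)) B) := by
            ext i j
            simp only [vec, Matrix.of_apply, ← map_mul, ← map_sum, ← ha, hφy, Matrix.smul_apply,
              Matrix.one_apply]
            split_ifs <;> simp
          rw [this, Matrix.det_smul, Matrix.det_one, mul_one]
          exact fun h => hc (q.2.mem_of_pow_mem _ h))
      have h1 := finrank_span_eq_card hlin
      rw [Fintype.card_fin] at h1
      have h2 : d + 1 ≤ residueRank q (insert (vec m) (Set.range fun j => vec (w j))) := by
        rw [← h1]
        apply Submodule.finrank_mono
        rw [Submodule.span_le]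
        rintro _ ⟨j, rfl⟩
        exact residueVec_mem_span ψ q w (hy j) _ fun j => Set.mem_insert_of_mem _ ⟨j, rfl⟩
      omega) (by
      intro q hq
      by_contra! hcon
      obtain ⟨hf, hm⟩ := hcon
      obtain ⟨a, φ, hφ⟩ := hum
      obtain ⟨b, hb⟩ := hψ' φ
      have h1 : ∀ i, algebraMap A B (ψ i m) ∈ q.asIdeal := fun i =>
        Ideal.algebraMap_residueField_eq_zero.1 (congrFun hm i)
      refine q.2.ne_top ((Ideal.eq_top_iff_one _).2 ?_)
      rw [← map_one (algebraMap A B), ← hφ, map_add, map_mul, hb, map_sum]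
      refine Ideal.add_mem _ (Ideal.mul_mem_left _ _ hf) (Ideal.sum_mem _ fun i _ => ?_)
      rw [map_mul]
      exact Ideal.mul_mem_left _ _ (h1 i))
  choose c' hc' using fun j => Ideal.Quotient.mk_surjective (I := I) (c j)
  refine ⟨∑ j, c' j • w j, Submodule.sum_mem _ fun j _ =>
    Submodule.smul_mem _ _ (Submodule.subset_span ⟨j, rfl⟩), ?_⟩
  intro q hq hu hht
  have h1 := hc ⟨q, hq⟩ ⟨hu, hht⟩
  have h2 : vec m + algebraMap A B f • ∑ j, c j • vec (w j) = vec (m + f • ∑ j, c' j • w j) := by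
    ext i
    simp only [vec, Pi.add_apply, Pi.smul_apply, Finset.sum_apply, smul_eq_mul, map_add, map_smul,
      map_mul, map_sum, ← hc']
    rfl
  rw [h2] at h1
  obtain ⟨i, hi⟩ := Function.ne_iff.1 h1
  exact ⟨ψ i, fun hmem => hi (Ideal.algebraMap_residueField_eq_zero.2 hmem)⟩

theorem exists_mem_forall_of_finite {A κ : Type*} [CommRing A] [Finite κ] (S : Submonoid A)
    (P : κ → A → Prop) (h : ∀ k, ∃ e ∈ S, P k e)
    (hmul : ∀ k, ∀ e ∈ S, ∀ e' ∈ S, P k e → P k (e' * e)) : ∃ e ∈ S, ∀ k, P k e := by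
  classical
  have := Fintype.ofFinite κ
  choose e he hP using h
  refine ⟨∏ k, e k, prod_mem fun k _ => he k, fun k => ?_⟩
  rw [← Finset.prod_erase_mul _ _ (Finset.mem_univ k)]
  exact hmul k _ (he k) _ (prod_mem fun j _ => he j) (hP k)

/-- If a localization of `M` is free, then `M` is free up to an element of the multiplicative
set. -/
theorem exists_dualFamily_of_basis {A B M MS : Type*} [CommRing A] [IsNoetherianRing A]
    (S : Submonoid A) [CommRing B] [Algebra A B] [IsLocalization S B] [AddCommGroup M] [Module A M]
    [Module.Finite A M] [AddCommGroup MS] [Module A MS] [Module B MS] [IsScalarTower A B MS]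
    (f : M →ₗ[A] MS) [IsLocalizedModule S f] {n : ℕ} (b : Module.Basis (Fin n) B MS) :
    ∃ c ∈ S, ∃ (φ : Fin n → M →ₗ[A] A) (x : Fin n → M),
      (∀ i j, φ i (x j) = if i = j then c else 0) ∧ ∀ u, ∑ j, φ j u • x j = c • u := by
  classical
  have hfp : Module.FinitePresentation A M := Module.finitePresentation_of_finite A M
  obtain ⟨t, ht, hx⟩ := exists_mem_forall_of_finite S (fun (i : Fin n) t => ∃ x, f x = t • b i)
    (fun i => by
      obtain ⟨⟨x, t⟩, hxt⟩ := IsLocalizedModule.surj S f (b i)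
      exact ⟨t, t.2, x, hxt.symm⟩)
    (fun i e _ e' _ ⟨x, hx⟩ => ⟨e' • x, by rw [map_smul, hx, smul_smul]⟩)
  choose x hx using hx
  obtain ⟨t', ht', hφ⟩ := exists_mem_forall_of_finite S (fun (i : Fin n) t => ∃ φ : M →ₗ[A] A,
      ∀ u, algebraMap A B (φ u) = t • b.coord i (f u))
    (fun i => by
      obtain ⟨h, s, hs⟩ := Module.FinitePresentation.exists_lift_of_isLocalizedModule S
        (Algebra.linearMap A B) (((b.coord i).restrictScalars A) ∘ₗ f)
      exact ⟨s, s.2, h, fun u => LinearMap.congr_fun hs u⟩)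
    (fun i e _ e' _ ⟨φ, hφ⟩ => ⟨e' • φ, fun u => by
      rw [LinearMap.smul_apply, smul_eq_mul, map_mul, hφ, mul_smul, Algebra.smul_def e']⟩)
  choose φ hφ using hφ
  obtain ⟨e₁, he₁, h₁⟩ := exists_mem_forall_of_finite S
    (fun (ij : Fin n × Fin n) e => e * φ ij.1 (x ij.2) = e * if ij.1 = ij.2 then t' * t else 0)
    (fun ij => by
      obtain ⟨i, j⟩ := ij
      have : algebraMap A B (φ i (x j)) = algebraMap A B (if i = j then t' * t else 0) := by
        rw [hφ, hx, ← algebraMap_smul B t (b j), map_smul, Module.Basis.coord_apply,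
          Module.Basis.repr_self, Finsupp.single_apply]
        by_cases h : i = j
        · simp [h, Algebra.smul_def]
        · simp [h, Ne.symm h]
      obtain ⟨c, hc⟩ := IsLocalization.exists_of_eq (M := S) this
      exact ⟨c, c.2, hc⟩)
    (fun ij e _ e' _ h => by rw [mul_assoc, h, mul_assoc])
  have h₂ : f ∘ₗ (∑ j, (φ j).smulRight (x j)) = f ∘ₗ ((t' * t) • LinearMap.id) := by
    ext u
    simp only [LinearMap.comp_apply, LinearMap.sum_apply, LinearMap.smulRight_apply, map_sum,
      map_smul, hx, LinearMap.smul_apply, LinearMap.id_apply]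
    conv_rhs => rw [← b.sum_repr (f u), Finset.smul_sum]
    refine Finset.sum_congr rfl fun j _ => ?_
    rw [← algebraMap_smul B (φ j u), hφ, Module.Basis.coord_apply, ← algebraMap_smul B t (b j),
      ← algebraMap_smul B (t' * t), smul_smul, smul_smul, map_mul, Algebra.smul_def]
    congr 1
    ring
  obtain ⟨e₂, he₂⟩ := Module.Finite.exists_smul_of_comp_eq_of_isLocalizedModule S f _ _ h₂
  refine ⟨(e₁ * e₂) * (t' * t), mul_mem (mul_mem he₁ e₂.2) (mul_mem ht' ht),
    fun i => (e₁ * e₂ : A) • φ i, x, fun i j => ?_, fun u => ?_⟩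
  · have := h₁ (i, j)
    simp only at this
    rw [LinearMap.smul_apply, smul_eq_mul, mul_comm e₁, mul_assoc, this]
    split_ifs <;> ring
  · have h3 : (e₂ : A) • ∑ j, φ j u • x j = (e₂ : A) • (t' * t) • u := by
      have := LinearMap.congr_fun he₂ u
      simpa [Submonoid.smul_def] using this
    simp only [LinearMap.smul_apply, smul_assoc, ← Finset.smul_sum]
    rw [mul_smul, h3, ← mul_smul, ← mul_smul]

theorem HasDualFamilyAt.mono {A M : Type*} [CommRing A] [AddCommGroup M] [Module A M]
    {W : Submodule A M} {P : Ideal A} {r r' : ℕ} (h : HasDualFamilyAt W P r) (hr : r' ≤ r) :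
    HasDualFamilyAt W P r' := by
  obtain ⟨c, hc, φ, y, hy, hφ⟩ := h
  refine ⟨c, hc, fun i => φ (Fin.castLE hr i), fun i => y (Fin.castLE hr i), fun i => hy _, ?_⟩
  intro i j
  rw [hφ]
  simp

theorem HasDualFamilyAt.of_isLocalizedModule {A B M MS : Type*} [CommRing A] [IsNoetherianRing A]
    (S : Submonoid A) [CommRing B] [Algebra A B] [IsLocalization S B] [AddCommGroup M] [Module A M]
    [Module.Finite A M] [AddCommGroup MS] [Module A MS] [Module B MS] [IsScalarTower A B MS]
    (f : M →ₗ[A] MS) [IsLocalizedModule S f] (q : Ideal B) (hq : q.IsPrime) {r : ℕ}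
    (h : HasDualFamilyAt (⊤ : Submodule B MS) q r) :
    HasDualFamilyAt (⊤ : Submodule A M) (q.comap (algebraMap A B)) r := by
  classical
  have hfp : Module.FinitePresentation A M := Module.finitePresentation_of_finite A M
  have hS : ∀ t ∈ S, algebraMap A B t ∉ q := fun t ht htq =>
    hq.ne_top (Ideal.eq_top_of_isUnit_mem _ htq (IsLocalization.map_units B ⟨t, ht⟩))
  obtain ⟨c, hc, ψ, b, -, hψ⟩ := h
  obtain ⟨t, ht, hx⟩ := exists_mem_forall_of_finite S (fun (i : Fin r) t => ∃ x, f x = t • b i)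
    (fun i => by
      obtain ⟨⟨x, t⟩, hxt⟩ := IsLocalizedModule.surj S f (b i)
      exact ⟨t, t.2, x, hxt.symm⟩)
    (fun i e _ e' _ ⟨x, hx⟩ => ⟨e' • x, by rw [map_smul, hx, smul_smul]⟩)
  choose x hx using hx
  obtain ⟨t', ht', hφ⟩ := exists_mem_forall_of_finite S (fun (i : Fin r) t => ∃ φ : M →ₗ[A] A,
      ∀ u, algebraMap A B (φ u) = t • ψ i (f u))
    (fun i => by
      obtain ⟨h, s, hs⟩ := Module.FinitePresentation.exists_lift_of_isLocalizedModule S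
        (Algebra.linearMap A B) (((ψ i).restrictScalars A) ∘ₗ f)
      exact ⟨s, s.2, h, fun u => LinearMap.congr_fun hs u⟩)
    (fun i e _ e' _ ⟨φ, hφ⟩ => ⟨e' • φ, fun u => by
      rw [LinearMap.smul_apply, smul_eq_mul, map_mul, hφ, mul_smul, Algebra.smul_def e']⟩)
  choose φ hφ using hφ
  obtain ⟨⟨c₀, t''⟩, hc₀⟩ := IsLocalization.surj S c
  simp only at hc₀
  obtain ⟨e₁, he₁, h₁⟩ := exists_mem_forall_of_finite S
    (fun (ij : Fin r × Fin r) e =>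
      e * (t'' * φ ij.1 (x ij.2)) = e * if ij.1 = ij.2 then t' * t * c₀ else 0)
    (fun ij => by
      obtain ⟨i, j⟩ := ij
      have : algebraMap A B (t'' * φ i (x j)) =
          algebraMap A B (if i = j then t' * t * c₀ else 0) := by
        rw [map_mul, hφ, hx, ← algebraMap_smul B t (b j), map_smul, hψ]
        by_cases h : i = j
        · simp only [h, Algebra.smul_def, if_true, map_mul, ← hc₀, Algebra.algebraMap_self,
            RingHom.id_apply]
          ring
        · simp [h]
      obtain ⟨c, hc⟩ := IsLocalization.exists_of_eq (M := S) this
      exact ⟨c, c.2, hc⟩)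
    (fun ij e _ e' _ h => by rw [mul_assoc, h, mul_assoc e'])
  refine ⟨e₁ * (t' * t * c₀), ?_, fun i => (e₁ * t'' : A) • φ i, x, fun _ => trivial, ?_⟩
  · rw [Ideal.mem_comap, map_mul, map_mul, map_mul, ← hc₀]
    have := hS _ he₁
    have := hS _ ht'
    have := hS _ ht
    have := hS _ t''.2
    simp only [hq.mul_mem_iff_mem_or_mem]
    tauto
  · intro i j
    have := h₁ (i, j)
    simp only at this
    rw [LinearMap.smul_apply, smul_eq_mul, mul_assoc, this]
    split_ifs <;> ring

theorem le_of_hasDualFamilyAt {A M : Type*} [CommRing A] [AddCommGroup M] [Module A M]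
    {W : Submodule A M} {P : Ideal A} (hP : P.IsPrime) {r n : ℕ} (h : HasDualFamilyAt W P r)
    {c : A} (hc : c ∉ P) (φ : Fin n → M →ₗ[A] A) (x : Fin n → M)
    (hx : ∀ u, ∑ j, φ j u • x j = c • u) : r ≤ n := by
  classical
  obtain ⟨c', hc', φ', y, -, hφ'⟩ := h
  set K := P.ResidueField
  let M₁ : Matrix (Fin r) (Fin n) K := Matrix.of fun i k => algebraMap A K (φ' i (x k))
  let M₂ : Matrix (Fin n) (Fin r) K := Matrix.of fun k j => algebraMap A K (φ k (y j))
  have h1 : M₁ * M₂ = algebraMap A K (c * c') • 1 := by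
    ext i j
    simp only [M₁, M₂, Matrix.mul_apply, Matrix.of_apply, ← map_mul, ← map_sum, Matrix.smul_apply,
      Matrix.one_apply, smul_eq_mul]
    have : ∑ k, φ' i (x k) * φ k (y j) = φ' i (c • y j) := by
      rw [← hx, map_sum]
      refine Finset.sum_congr rfl fun k _ => ?_
      rw [map_smul, smul_eq_mul, mul_comm]
    rw [this, map_smul, hφ']
    split_ifs <;> simp
  have h2 : algebraMap A K (c * c') ≠ 0 := by
    rw [Ne, Ideal.algebraMap_residueField_eq_zero, hP.mul_mem_iff_mem_or_mem]
    tauto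
  have h3 : IsUnit (M₁ * M₂) := by
    rw [h1, Matrix.isUnit_iff_isUnit_det, Matrix.det_smul, Matrix.det_one, mul_one]
    exact (IsUnit.mk0 _ h2).pow _
  calc r = (M₁ * M₂).rank := by rw [Matrix.rank_of_isUnit _ h3, Fintype.card_fin]
    _ ≤ M₁.rank := Matrix.rank_mul_le_left _ _
    _ ≤ n := Matrix.rank_le_width _

theorem exists_dualFamily_of_projective {A M : Type*} [CommRing A] [IsNoetherianRing A]
    [AddCommGroup M] [Module A M] [Module.Finite A M] [Module.Projective A M]
    (P : Ideal A) (hP : P.IsPrime) :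
    ∃ c ∉ P, ∃ (φ : Fin (rankAt M P hP) → M →ₗ[A] A) (x : Fin (rankAt M P hP) → M),
      (∀ i j, φ i (x j) = if i = j then c else 0) ∧ ∀ u, ∑ j, φ j u • x j = c • u := by
  have : Module.Free (Localization P.primeCompl) (LocalizedModule P.primeCompl M) :=
    Module.free_of_flat_of_isLocalRing (R := Localization.AtPrime P)
  obtain ⟨c, hc, h⟩ := exists_dualFamily_of_basis P.primeCompl
    (LocalizedModule.mkLinearMap P.primeCompl M)
    (Module.finBasis (Localization P.primeCompl) (LocalizedModule P.primeCompl M))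
  exact ⟨c, hc, h⟩

theorem hasDualFamilyAt_of_notMem {A M : Type*} [CommRing A] [IsNoetherianRing A]
    [AddCommGroup M] [Module A M] [Module.Finite A M] (g : A) {r : ℕ}
    (hproj : Module.Projective (Localization (Submonoid.powers g))
      (LocalizedModule (Submonoid.powers g) M))
    (hrank : ∀ (q : Ideal (Localization (Submonoid.powers g))) (hq : q.IsPrime),
      r ≤ rankAt (R := Localization (Submonoid.powers g))
        (LocalizedModule (Submonoid.powers g) M) q hq)
    (P : Ideal A) (hP : P.IsPrime) (hg : g ∉ P) : HasDualFamilyAt (⊤ : Submodule A M) P r := by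
  have hdisj : Disjoint (Submonoid.powers g : Set A) (P : Set A) := by
    rw [Set.disjoint_left]
    rintro _ ⟨n, rfl⟩ h
    exact hg (hP.mem_of_pow_mem _ h)
  set B := Localization (Submonoid.powers g)
  have hN : IsNoetherianRing B := IsLocalization.isNoetherianRing (Submonoid.powers g) B inferInstance
  have hF : Module.Finite B (LocalizedModule (Submonoid.powers g) M) :=
    Module.Finite.of_isLocalizedModule (Submonoid.powers g)
      (LocalizedModule.mkLinearMap (Submonoid.powers g) M)
  have hq := IsLocalization.isPrime_of_isPrime_disjoint (Submonoid.powers g) B P hP hdisj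
  have hqP := IsLocalization.under_map_of_isPrime_disjoint (Submonoid.powers g) B hP hdisj
  have h1 : HasDualFamilyAt (⊤ : Submodule B (LocalizedModule (Submonoid.powers g) M))
      (P.map (algebraMap A B)) r := by
    obtain ⟨c, hc, φ, x, h, -⟩ := exists_dualFamily_of_projective
      (M := LocalizedModule (Submonoid.powers g) M) _ hq
    exact HasDualFamilyAt.mono ⟨c, hc, φ, x, fun _ => trivial, h⟩ (hrank _ hq)
  have h2 := HasDualFamilyAt.of_isLocalizedModule (Submonoid.powers g)
    (LocalizedModule.mkLinearMap (Submonoid.powers g) M) _ hq h1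
  change HasDualFamilyAt _ ((P.map (algebraMap A B)).under A) r at h2
  rwa [hqP] at h2

theorem hasDualFamilyAt_of_projective {A M : Type*} [CommRing A] [IsNoetherianRing A]
    [AddCommGroup M] [Module A M] [Module.Finite A M] [Module.Projective A M] {g : A}
    (hgnzd : g ∈ nonZeroDivisors A) {r : ℕ}
    (h : ∀ P : Ideal A, P.IsPrime → g ∉ P → HasDualFamilyAt (⊤ : Submodule A M) P r)
    (P : Ideal A) (hP : P.IsPrime) : HasDualFamilyAt (⊤ : Submodule A M) P r := by
  obtain ⟨P₀, hP₀, hle⟩ := Ideal.exists_minimalPrimes_le (I := ⊥) (J := P) bot_le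
  have hgP₀ : g ∉ P₀ := fun hmem =>
    (Set.disjoint_left.1 (Ideal.disjoint_nonZeroDivisors_of_mem_minimalPrimes hP₀)) hmem hgnzd
  obtain ⟨c, hc, φ, x, h1, h2⟩ := exists_dualFamily_of_projective (M := M) P hP
  exact HasDualFamilyAt.mono ⟨c, hc, φ, x, fun _ => trivial, h1⟩
    (le_of_hasDualFamilyAt hP₀.1.1 (h P₀ hP₀.1.1 hgP₀) (fun hcc => hc (hle hcc)) φ x h2)

theorem eq_zero_of_forall_mem_minimalPrimes {R : Type*} [CommRing R] [IsReduced R] {c : R}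
    (h : ∀ p ∈ minimalPrimes R, c ∈ p) : c = 0 := by
  have h1 : c ∈ (⊥ : Ideal R).radical := by
    rw [← Ideal.sInf_minimalPrimes, Ideal.mem_sInf]
    intro p hp
    exact h p hp
  obtain ⟨n, hn⟩ := h1
  exact IsNilpotent.eq_zero ⟨n, hn⟩

theorem exists_separating_minimalPrimes (R : Type*) [CommRing R] [IsNoetherianRing R] :
    ∃ e : minimalPrimes R → R, (∀ p, e p ∉ p.1) ∧ ∀ p q, q ≠ p → e p ∈ q.1 := by
  classical
  have hfin : Finite (minimalPrimes R) := minimalPrimes.finite_of_isNoetherianRing R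
  have := Fintype.ofFinite (minimalPrimes R)
  have : ∀ p : minimalPrimes R, ∃ e, e ∉ p.1 ∧ ∀ q, q ≠ p → e ∈ q.1 := by
    intro p
    have h1 : ¬ (Finset.univ.erase p).inf (fun q : minimalPrimes R => q.1) ≤ p.1 := by
      rw [p.2.1.1.inf_le']
      rintro ⟨q, hq, hqp⟩
      have := p.2.2 ⟨q.2.1.1, bot_le⟩ hqp
      exact Finset.ne_of_mem_erase hq (Subtype.ext (le_antisymm hqp this))
    obtain ⟨r, hr, hrp⟩ := SetLike.not_le_iff_exists.1 h1
    refine ⟨r, hrp, fun q hq => ?_⟩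
    exact (Finset.inf_le (f := fun q : minimalPrimes R => q.1)
      (Finset.mem_erase.2 ⟨hq, Finset.mem_univ _⟩)) hr
  choose e he using this
  exact ⟨e, fun p => (he p).1, fun p => (he p).2⟩

theorem mem_nonZeroDivisors_of_forall_minimalPrimes {R : Type*} [CommRing R] [IsReduced R]
    (A : Subalgebra R R[X]) {a : A}
    (h : ∀ p ∈ minimalPrimes R, (a : R[X]).map (Ideal.Quotient.mk p) ≠ 0) :
    a ∈ nonZeroDivisors A := by
  rw [mem_nonZeroDivisors_iff_right]
  intro b hb
  have hb' : (b : R[X]) * (a : R[X]) = 0 := congrArg Subtype.val hb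
  apply Subtype.ext
  ext n
  change (b : R[X]).coeff n = 0
  apply eq_zero_of_forall_mem_minimalPrimes
  intro p hp
  have hpp : p.IsPrime := hp.1.1
  have h1 := congrArg (Polynomial.map (Ideal.Quotient.mk p)) hb'
  rw [Polynomial.map_mul, Polynomial.map_zero, mul_eq_zero] at h1
  have h2 := h1.resolve_right (h p hp)
  have h3 := congrArg (fun f => coeff f n) h2
  simp only [coeff_map, coeff_zero] at h3
  exact Ideal.Quotient.eq_zero_iff_mem.1 h3

theorem mem_nonZeroDivisors_iff_notMem_minimalPrimes {R : Type*} [CommRing R] [IsReduced R]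
    {s : R} : s ∈ nonZeroDivisors R ↔ ∀ p ∈ minimalPrimes R, s ∉ p := by
  constructor
  · intro h p hp hs
    exact (Set.disjoint_left.1 (Ideal.disjoint_nonZeroDivisors_of_mem_minimalPrimes hp)) hs h
  · intro h
    rw [mem_nonZeroDivisors_iff_right]
    intro b hb
    apply eq_zero_of_forall_mem_minimalPrimes
    intro p hp
    exact (hp.1.1.mem_or_mem (hb ▸ p.zero_mem : b * s ∈ p)).resolve_right (h p hp)

/-- The map from a subring of `R[T]` to the polynomials over the residue field of a minimal
prime. -/
noncomputable def toResiduePoly {R : Type*} [CommRing R] (A : Subalgebra R R[X]) (p : Ideal R) :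
    A →+* (FractionRing (R ⧸ p))[X] :=
  (mapRingHom ((algebraMap (R ⧸ p) (FractionRing (R ⧸ p))).comp (Ideal.Quotient.mk p))).comp
    A.val.toRingHom

theorem toResiduePoly_eq_zero_iff {R : Type*} [CommRing R] (A : Subalgebra R R[X])
    {p : Ideal R} [p.IsPrime] (a : A) :
    toResiduePoly A p a = 0 ↔ ∀ n, (a : R[X]).coeff n ∈ p := by
  rw [Polynomial.ext_iff]
  refine forall_congr' fun n => ?_
  change (map _ (a : R[X])).coeff n = _ ↔ _
  rw [coeff_map, coeff_zero, RingHom.comp_apply,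
    FaithfulSMul.algebraMap_eq_zero_iff, Ideal.Quotient.eq_zero_iff_mem]

theorem isLocalization_toResiduePoly {R : Type*} [CommRing R] [IsNoetherianRing R] [IsReduced R]
    (A : Subalgebra R R[X]) {s : R} (hs : s ∈ nonZeroDivisors R)
    (hsA : ∀ f : R[X], ∃ k : ℕ, (C s) ^ k * f ∈ A) {p : Ideal R} [p.IsPrime]
    (hp : p ∈ minimalPrimes R) :
    let := (toResiduePoly A p).toAlgebra
    IsLocalization (Algebra.algebraMapSubmonoid A p.primeCompl) (FractionRing (R ⧸ p))[X] := by
  let := (toResiduePoly A p).toAlgebra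
  have halg : ∀ a : A, algebraMap A (FractionRing (R ⧸ p))[X] a = toResiduePoly A p a :=
    fun _ => rfl
  have halgC : ∀ r : R, toResiduePoly A p (algebraMap R A r) =
      C (algebraMap (R ⧸ p) (FractionRing (R ⧸ p)) (Ideal.Quotient.mk p r)) := by
    intro r
    change map _ (C r) = _
    rw [map_C]
    rfl
  have hsp := mem_nonZeroDivisors_iff_notMem_minimalPrimes.1 hs p hp
  have hne : ∀ t : R, t ∉ p → algebraMap (R ⧸ p) (FractionRing (R ⧸ p)) (Ideal.Quotient.mk p t) ≠ 0 := by
    intro t ht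
    rwa [Ne, FaithfulSMul.algebraMap_eq_zero_iff, Ideal.Quotient.eq_zero_iff_mem]
  rw [isLocalization_iff]
  refine ⟨?_, ?_, ?_⟩
  · rintro ⟨_, t, ht, rfl⟩
    change IsUnit (algebraMap A _ (algebraMap R A t))
    rw [halg, halgC]
    exact isUnit_C.2 (IsUnit.mk0 _ (hne t ht))
  · intro z
    obtain ⟨b, hb⟩ := IsLocalization.integerNormalization_spec (nonZeroDivisors (R ⧸ p)) z
    obtain ⟨t, ht⟩ := Ideal.Quotient.mk_surjective b
    obtain ⟨F, hF⟩ := Polynomial.map_surjective _ Ideal.Quotient.mk_surjective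
      (IsLocalization.integerNormalization (nonZeroDivisors (R ⧸ p)) z)
    obtain ⟨k, hk⟩ := hsA F
    have htp : t ∉ p := by
      rw [← Ideal.Quotient.eq_zero_iff_mem, ht]
      exact nonZeroDivisors.ne_zero hb.1
    refine ⟨⟨⟨_, hk⟩, ⟨algebraMap R A (s ^ k * t), _, ?_, rfl⟩⟩, ?_⟩
    · exact p.primeCompl.mul_mem (p.primeCompl.pow_mem hsp k) htp
    · simp only [halg, halgC]
      change _ = map _ (C s ^ k * F)
      rw [Polynomial.map_mul, Polynomial.map_pow, map_C, ← Polynomial.map_map, hF]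
      ext n
      rw [mul_comm, coeff_C_mul, map_mul, map_mul, ht, map_pow, map_pow, ← C_pow, coeff_C_mul,
        coeff_map, ← coeff_map, hb.2, mul_assoc, coeff_smul, Algebra.smul_def]
      rfl
  · intro x y hxy
    obtain ⟨e, he, he'⟩ := exists_separating_minimalPrimes R
    refine ⟨⟨algebraMap R A (e ⟨p, hp⟩), _, he ⟨p, hp⟩, rfl⟩, ?_⟩
    rw [halg, halg, ← sub_eq_zero, ← map_sub, toResiduePoly_eq_zero_iff] at hxy
    rw [← sub_eq_zero, ← mul_sub]
    apply Subtype.ext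
    ext n
    change (C (e ⟨p, hp⟩) * ((x - y : A) : R[X])).coeff n = 0
    rw [coeff_C_mul]
    apply eq_zero_of_forall_mem_minimalPrimes
    intro q hq
    by_cases hqp : q = p
    · subst hqp
      exact Ideal.mul_mem_left _ _ (hxy n)
    · exact Ideal.mul_mem_right _ _ (he' ⟨p, hp⟩ ⟨q, hq⟩ (fun h => hqp (congrArg Subtype.val h)))

open TensorProduct in
theorem exists_dualFamily_of_isPrincipalIdealRing {A M : Type*} (B : Type*) [CommRing A]
    [IsNoetherianRing A] [AddCommGroup M] [Module A M] [Module.Finite A M] [CommRing B] [IsDomain B]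
    [IsPrincipalIdealRing B] [Algebra A B] (S : Submonoid A) [IsLocalization S B]
    (htf : ∀ a : A, algebraMap A B a ≠ 0 → ∀ u : M, a • u = 0 → ∃ e ∈ S, e • u = 0) :
    ∃ (n : ℕ), ∃ c ∈ S, ∃ (φ : Fin n → M →ₗ[A] A) (x : Fin n → M),
      (∀ i j, φ i (x j) = if i = j then c else 0) ∧ ∀ u, ∑ j, φ j u • x j = c • u := by
  let f : M →ₗ[A] B ⊗[A] M := TensorProduct.mk A B M 1
  have hf : IsLocalizedModule S f :=
    (isLocalizedModule_iff_isBaseChange S B _).2 (TensorProduct.isBaseChange A M B)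
  have htf' : Module.IsTorsionFree B (B ⊗[A] M) := by
    apply Module.IsTorsionFree.of_smul_eq_zero
    intro b z hbz
    obtain ⟨⟨a, t⟩, hat⟩ := IsLocalization.surj S b
    obtain ⟨⟨u, t'⟩, hut⟩ := IsLocalizedModule.surj S f z
    by_contra! hne
    simp only at hat hut
    have h1 : f (a • u) = 0 := by
      rw [map_smul, ← hut, ← algebraMap_smul B a, ← hat, Submonoid.smul_def, smul_comm, mul_comm,
        mul_smul, hbz, smul_zero, smul_zero]
    obtain ⟨c, hc⟩ := (IsLocalizedModule.eq_zero_iff S f).1 h1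
    have ha : algebraMap A B a ≠ 0 := by
      rw [← hat]
      exact mul_ne_zero hne.1 (IsLocalization.map_units B t).ne_zero
    obtain ⟨e, he, heu⟩ := htf a ha ((c : A) • u) (by rw [smul_comm]; exact hc)
    have h2 : f u = 0 := (IsLocalizedModule.eq_zero_iff S f).2
      ⟨⟨e, he⟩ * c, by rw [mul_smul]; exact heu⟩
    rw [h2] at hut
    have := IsLocalizedModule.smul_injective f t' (hut.trans (smul_zero t').symm)
    exact hne.2 this
  have hb := Module.finBasis B (B ⊗[A] M)
  exact ⟨_, exists_dualFamily_of_basis S f hb⟩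

theorem exists_dualFamily_of_minimalPrime {R : Type*} [CommRing R] [IsNoetherianRing R]
    [IsReduced R] (A : Subalgebra R R[X]) [IsNoetherianRing A] {s : R} (hs : s ∈ nonZeroDivisors R)
    (hsA : ∀ f : R[X], ∃ k : ℕ, (C s) ^ k * f ∈ A) {M : Type*} [AddCommGroup M] [Module A M]
    [Module.Finite A M] (htf : ∀ m : M, ∀ a ∈ nonZeroDivisors A, a • m = 0 → m = 0)
    {p : Ideal R} (hp : p ∈ minimalPrimes R) :
    ∃ (n : ℕ) (γ : R), γ ∉ p ∧ ∃ (φ : Fin n → M →ₗ[A] A) (x : Fin n → M),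
      (∀ i j, φ i (x j) = if i = j then algebraMap R A γ else 0) ∧
        ∀ u, ∑ j, φ j u • x j = algebraMap R A γ • u := by
  classical
  have : p.IsPrime := hp.1.1
  let _ : Algebra A (FractionRing (R ⧸ p))[X] := (toResiduePoly A p).toAlgebra
  have halg : ∀ a : A, algebraMap A (FractionRing (R ⧸ p))[X] a = toResiduePoly A p a :=
    fun _ => rfl
  have : IsLocalization (Algebra.algebraMapSubmonoid A p.primeCompl) (FractionRing (R ⧸ p))[X] :=
    isLocalization_toResiduePoly A hs hsA hp
  obtain ⟨e, he, he'⟩ := exists_separating_minimalPrimes R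
  have : Finite (minimalPrimes R) := minimalPrimes.finite_of_isNoetherianRing R
  have := Fintype.ofFinite (minimalPrimes R)
  obtain ⟨n, _, ⟨γ, hγ, rfl⟩, φ, x, h1, h2⟩ := exists_dualFamily_of_isPrincipalIdealRing (M := M)
    (FractionRing (R ⧸ p))[X] (Algebra.algebraMapSubmonoid A p.primeCompl) (by
      intro a ha u hu
      refine ⟨_, ⟨e ⟨p, hp⟩, he ⟨p, hp⟩, rfl⟩, ?_⟩
      rw [halg, Ne, toResiduePoly_eq_zero_iff] at ha
      push Not at ha
      obtain ⟨k, hk⟩ := ha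
      have hcross : ∀ q, q ≠ ⟨p, hp⟩ → e ⟨p, hp⟩ * e q = 0 := by
        intro q hq
        apply eq_zero_of_forall_mem_minimalPrimes
        intro q' hq'
        by_cases h : q' = p
        · subst h
          exact Ideal.mul_mem_left _ _ (he' q ⟨q', hp⟩ hq.symm)
        · exact Ideal.mul_mem_right _ _ (he' ⟨p, hp⟩ ⟨q', hq'⟩ fun h' => h (congrArg Subtype.val h'))
      refine htf _ (algebraMap R A (e ⟨p, hp⟩) * a +
        algebraMap R A (∑ q ∈ Finset.univ.erase ⟨p, hp⟩, e q)) ?_ ?_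
      · apply mem_nonZeroDivisors_of_forall_minimalPrimes
        intro q hq h0
        have hq' : q.IsPrime := hq.1.1
        have h1 : ∀ j, e ⟨p, hp⟩ * (a : R[X]).coeff j + (C (∑ q ∈ Finset.univ.erase ⟨p, hp⟩, e q)).coeff j ∈ q := by
          intro j
          rw [← Ideal.Quotient.eq_zero_iff_mem, ← coeff_C_mul, ← coeff_add, ← coeff_map]
          exact (congrArg (fun f => coeff f j) h0).trans (coeff_zero j)
        by_cases h : q = p
        · subst h
          refine (hq'.mem_or_mem (((Ideal.add_mem_iff_left _ ?_).1 (h1 k)))).elim (he ⟨q, hp⟩) hk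
          rw [coeff_C]
          split_ifs
          · exact Ideal.sum_mem _ fun q' hq' => he' _ _ (Finset.ne_of_mem_erase hq').symm
          · exact zero_mem _
        · have hne : (⟨q, hq⟩ : minimalPrimes R) ≠ ⟨p, hp⟩ := fun h' => h (congrArg Subtype.val h')
          have h2 := (Ideal.add_mem_iff_right _ (Ideal.mul_mem_right _ _ (he' ⟨p, hp⟩ ⟨q, hq⟩ hne))).1 (h1 0)
          rw [coeff_C_zero, ← Finset.add_sum_erase _ _ (Finset.mem_erase.2 ⟨hne, Finset.mem_univ _⟩),
            Ideal.add_mem_iff_left] at h2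
          · exact he ⟨q, hq⟩ h2
          · exact Ideal.sum_mem _ fun q' hq' => he' _ _ (Finset.ne_of_mem_erase hq').symm
      · rw [add_smul, smul_smul, mul_right_comm, mul_smul, hu, smul_zero, zero_add, smul_smul,
          ← map_mul, Finset.sum_mul, Finset.sum_eq_zero, map_zero, zero_smul]
        intro q hq
        rw [mul_comm]
        exact hcross q (Finset.ne_of_mem_erase hq))
  exact ⟨_, γ, hγ, φ, x, h1, h2⟩

/-- `M` is free of rank at least `r` over the total ring of fractions of `R`, up to powers of `s`
and with possibly varying rank. -/
theorem exists_dualFamily_of_torsionFree {R : Type*} [CommRing R] [IsNoetherianRing R]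
    [IsReduced R] (A : Subalgebra R R[X]) [IsNoetherianRing A] {s : R} (hs : s ∈ nonZeroDivisors R)
    (hsA : ∀ f : R[X], ∃ k : ℕ, (C s) ^ k * f ∈ A) {M : Type*} [AddCommGroup M] [Module A M]
    [Module.Finite A M] (htf : ∀ m : M, ∀ a ∈ nonZeroDivisors A, a • m = 0 → m = 0)
    {g : A} (hg : g ∈ nonZeroDivisors A) {t : ℕ}
    (h : ∀ P : Ideal A, P.IsPrime → g ∉ P → HasDualFamilyAt (⊤ : Submodule A M) P t) :
    ∃ s ∈ nonZeroDivisors R, (∀ f : R[X], ∃ k : ℕ, (C s) ^ k * f ∈ A) ∧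
      ∃ (n : ℕ) (r : ℕ → R) (φ : ℕ → M →ₗ[A] A) (x : ℕ → M),
        (∀ i j, φ i (x j) = if i = j then algebraMap R A (r i) else 0) ∧
        (∀ u, ∑ j ∈ Finset.range n, φ j u • x j = algebraMap R A s • u) ∧ ∀ j < t, r j = s := by
  classical
  have : Finite (minimalPrimes R) := minimalPrimes.finite_of_isNoetherianRing R
  have := Fintype.ofFinite (minimalPrimes R)
  have hfam : ∀ p : minimalPrimes R, ∃ (n : ℕ) (γ : R), t ≤ n ∧ γ ∉ p.1 ∧
      ∃ (φ : Fin n → M →ₗ[A] A) (x : Fin n → M),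
      (∀ i j, φ i (x j) = if i = j then algebraMap R A (s * γ) else 0) ∧
        ∀ u, ∑ j, φ j u • x j = algebraMap R A (s * γ) • u := by
    intro p
    have hp : p.1.IsPrime := p.2.1.1
    obtain ⟨n, γ, hγ, φ, x, hφ, hx⟩ := exists_dualFamily_of_minimalPrime A hs hsA htf p.2
    refine ⟨n, γ, ?_, hγ, fun i => algebraMap R A s • φ i, x, fun i j => ?_, fun u => ?_⟩
    · have hgp : toResiduePoly A p.1 g ≠ 0 := by
        rw [Ne, toResiduePoly_eq_zero_iff]
        intro h0
        obtain ⟨e, he, he'⟩ := exists_separating_minimalPrimes R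
        have h1 : algebraMap R A (e p) * g = 0 := by
          apply Subtype.ext
          ext k
          change (C (e p) * (g : R[X])).coeff k = 0
          rw [coeff_C_mul]
          apply eq_zero_of_forall_mem_minimalPrimes
          intro q hq
          by_cases hqp : q = p
          · subst hqp
            exact Ideal.mul_mem_left _ _ (h0 k)
          · exact Ideal.mul_mem_right _ _ (he' p ⟨q, hq⟩ fun h' => hqp (congrArg Subtype.val h'))
        have h2 := (mem_nonZeroDivisors_iff_right.1 hg) _ h1
        have h3 : e p = 0 := C_injective ((congrArg Subtype.val h2).trans C_0.symm)
        exact he p (h3 ▸ zero_mem _)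
      have hγ' : algebraMap R A γ ∉ RingHom.ker (toResiduePoly A p.1) := by
        rw [RingHom.mem_ker, toResiduePoly_eq_zero_iff]
        intro h0
        exact hγ (by simpa using h0 0)
      exact le_of_hasDualFamilyAt (RingHom.ker_isPrime _)
        (h (RingHom.ker (toResiduePoly A p.1)) (RingHom.ker_isPrime _) hgp) hγ' φ x hx
    · rw [LinearMap.smul_apply, hφ, map_mul, smul_eq_mul]
      split_ifs <;> simp
    · simp only [LinearMap.smul_apply, smul_assoc, ← Finset.smul_sum]
      rw [hx, map_mul, mul_smul]
  choose n γ htn hγ φ x hφ hx using hfam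
  obtain ⟨e, he, he'⟩ := exists_separating_minimalPrimes R
  have hcross : ∀ p q, p ≠ q → e p * e q = 0 := by
    intro p q hpq
    apply eq_zero_of_forall_mem_minimalPrimes
    intro q' hq'
    by_cases h : q' = p.1
    · subst h
      exact Ideal.mul_mem_left _ _ (he' q p hpq)
    · exact Ideal.mul_mem_right _ _ (he' p ⟨q', hq'⟩ fun h' => h (congrArg Subtype.val h'))
  have hcrossA : ∀ p q, p ≠ q → algebraMap R A (e p) * algebraMap R A (e q) = 0 := by
    intro p q hpq
    rw [← map_mul, hcross p q hpq, map_zero]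
  refine ⟨s * ∑ p, e p ^ 2 * γ p, mul_mem hs ?_, ?_, Finset.univ.sup n,
    fun j => ∑ p, if j < n p then e p ^ 2 * (s * γ p) else 0,
    fun j => ∑ p, algebraMap R A (e p) • if hj : j < n p then φ p ⟨j, hj⟩ else 0,
    fun j => ∑ p, algebraMap R A (e p) • if hj : j < n p then x p ⟨j, hj⟩ else 0, ?_, ?_, ?_⟩
  · rw [mem_nonZeroDivisors_iff_notMem_minimalPrimes]
    intro p hp
    have hp' : p.IsPrime := hp.1.1
    rw [← Finset.add_sum_erase _ _ (Finset.mem_univ ⟨p, hp⟩), Ideal.add_mem_iff_left]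
    · intro h0
      exact (hp'.mem_or_mem h0).elim (fun h1 => he ⟨p, hp⟩ (hp'.mem_of_pow_mem _ h1)) (hγ ⟨p, hp⟩)
    · refine Ideal.sum_mem _ fun q hq => Ideal.mul_mem_right _ _ ?_
      exact Ideal.pow_mem_of_mem _ (he' q ⟨p, hp⟩ (Finset.ne_of_mem_erase hq).symm) 2 two_pos
  · intro f
    obtain ⟨k, hk⟩ := hsA f
    refine ⟨k, ?_⟩
    rw [C_mul, mul_pow, mul_right_comm]
    exact A.mul_mem hk (A.pow_mem (A.algebraMap_mem _) k)
  · intro i j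
    simp only [LinearMap.sum_apply, LinearMap.smul_apply, map_sum, map_smul]
    have h1 : ∀ p, (∑ q, algebraMap R A (e q) • algebraMap R A (e p) •
        (if hi : i < n p then φ p ⟨i, hi⟩ else 0) (if hj : j < n q then x q ⟨j, hj⟩ else 0)) =
        if i = j then algebraMap R A (if i < n p then e p ^ 2 * (s * γ p) else 0) else 0 := by
      intro p
      rw [Finset.sum_eq_single p]
      · by_cases hi : i < n p
        · by_cases hj : j < n p
          · rw [dif_pos hi, dif_pos hj, hφ, if_pos hi]
            by_cases hij : i = j
            · subst hij
              simp
              ring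
            · rw [if_neg hij, if_neg (fun h => hij (Fin.mk.inj_iff.1 h)), smul_zero, smul_zero]
          · rw [dif_neg hj, map_zero, smul_zero, smul_zero, if_neg]
            rintro rfl
            exact hj hi
        · simp [hi]
      · intro q _ hq
        rw [smul_smul, hcrossA q p hq, zero_smul]
      · simp
    simp only [Finset.smul_sum]
    rw [Finset.sum_comm, Finset.sum_congr rfl fun p _ => h1 p]
    split_ifs <;> simp
  · intro u
    have h1 : ∀ j, (∑ p, algebraMap R A (e p) • if hj : j < n p then φ p ⟨j, hj⟩ else 0) u •
        (∑ p, algebraMap R A (e p) • if hj : j < n p then x p ⟨j, hj⟩ else 0) =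
        ∑ p, algebraMap R A (e p ^ 2) •
          if hj : j < n p then φ p ⟨j, hj⟩ u • x p ⟨j, hj⟩ else 0 := by
      intro j
      simp only [LinearMap.sum_apply, LinearMap.smul_apply, Finset.sum_smul, Finset.smul_sum]
      refine Finset.sum_congr rfl fun p _ => ?_
      rw [Finset.sum_eq_single p]
      · by_cases hj : j < n p
        · simp only [dif_pos hj, smul_smul, map_pow, smul_eq_mul]
          congr 1
          ring
        · simp [hj]
      · intro q _ hq
        rw [smul_eq_mul, mul_comm, mul_smul, smul_smul (algebraMap R A (e q)), hcrossA q p hq,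
          zero_smul, smul_zero]
      · simp
    simp only [h1]
    rw [Finset.sum_comm, Finset.mul_sum, map_sum, Finset.sum_smul]
    refine Finset.sum_congr rfl fun p _ => ?_
    rw [← Finset.smul_sum, mul_left_comm, map_mul, mul_smul, ← hx p u]
    congr 1
    rw [← Finset.sum_subset (Finset.range_subset_range.2 (Finset.le_sup (Finset.mem_univ p) : n p ≤ _)),
      Finset.sum_range]
    · refine Finset.sum_congr rfl fun j _ => ?_
      rw [dif_pos j.2]
    · intro j _ hj
      rw [dif_neg (by simpa using hj)]
  · intro j hj
    rw [Finset.mul_sum]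
    refine Finset.sum_congr rfl fun p _ => ?_
    rw [if_pos (hj.trans_le (htn p))]
    ring

/-- Two elements of a module are in the same orbit under its automorphisms. -/
def SameOrbit (A : Type*) {E : Type*} [CommRing A] [AddCommGroup E] [Module A E] (v w : E) : Prop :=
  ∃ α : E ≃ₗ[A] E, α v = w

theorem SameOrbit.refl {A E : Type*} [CommRing A] [AddCommGroup E] [Module A E] (v : E) :
    SameOrbit A v v := ⟨LinearEquiv.refl A E, rfl⟩

theorem SameOrbit.symm {A E : Type*} [CommRing A] [AddCommGroup E] [Module A E] {v w : E}
    (h : SameOrbit A v w) : SameOrbit A w v := by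
  obtain ⟨α, rfl⟩ := h
  exact ⟨α.symm, α.symm_apply_apply v⟩

theorem SameOrbit.trans {A E : Type*} [CommRing A] [AddCommGroup E] [Module A E] {u v w : E}
    (h : SameOrbit A u v) (h' : SameOrbit A v w) : SameOrbit A u w := by
  obtain ⟨α, rfl⟩ := h
  obtain ⟨β, rfl⟩ := h'
  exact ⟨α.trans β, rfl⟩

theorem sameOrbit_add_smul {A E : Type*} [CommRing A] [AddCommGroup E] [Module A E]
    (ψ : E →ₗ[A] A) {w : E} (h : ψ w = 0) (v : E) : SameOrbit A v (v + ψ v • w) :=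
  ⟨LinearEquiv.transvection h, rfl⟩

theorem sameOrbit_snd_add_smul {A M : Type*} [CommRing A] [AddCommGroup M] [Module A M]
    (f : A) (m y : M) : SameOrbit A (f, m) (f, m + f • y) := by
  simpa using sameOrbit_add_smul (LinearMap.fst A A M) (w := ((0 : A), y)) rfl (f, m)

theorem sameOrbit_fst_add {A M : Type*} [CommRing A] [AddCommGroup M] [Module A M]
    (f : A) (m : M) (φ : M →ₗ[A] A) : SameOrbit A (f, m) (f + φ m, m) := by
  simpa using sameOrbit_add_smul (φ ∘ₗ LinearMap.snd A A M) (w := ((1 : A), (0 : M))) (by simp) (f, m)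

/-- A matrix of determinant one acts on `A × A x`. -/
theorem sameOrbit_of_matrix {A M : Type*} [CommRing A] [AddCommGroup M] [Module A M]
    (φ : M →ₗ[A] A) (x : M) {s p q r t : A} (hs : φ x = s) (h : p + t + s * p * t - q * r = 0)
    (a b : A) (u : M) (hu : φ u = 0) :
    SameOrbit A (a, b • x + u) (a + s * (p * a + q * b), (b + r * a + s * (t * b)) • x + u) := by
  let op : A → A → A → A → (A × M →ₗ[A] A × M) := fun p q r t =>
    LinearMap.id + LinearMap.prod ((s * p) • LinearMap.fst A A M + q • φ ∘ₗ LinearMap.snd A A M)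
      ((r • LinearMap.fst A A M + t • φ ∘ₗ LinearMap.snd A A M).smulRight x)
  have hop : ∀ p q r t v, op p q r t v =
      (v.1 + (s * p * v.1 + q * φ v.2), v.2 + (r * v.1 + t * φ v.2) • x) := fun _ _ _ _ _ => rfl
  have hinv : ∀ p q r t : A, p + t + s * p * t - q * r = 0 → ∀ v,
      op t (-q) (-r) p (op p q r t v) = v := by
    intro p q r t h v
    rw [hop, hop]
    simp only [map_add, map_smul, hs, smul_eq_mul]
    ext
    · simp only
      linear_combination (s * v.1) * h
    · simp only
      rw [add_assoc, ← add_smul]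
      convert add_zero v.2
      convert zero_smul A x
      linear_combination (φ v.2) * h
  refine ⟨LinearEquiv.ofLinearMap (op p q r t) (op t (-q) (-r) p) ?_ ?_, ?_⟩
  · refine LinearMap.ext fun v => ?_
    have := hinv t (-q) (-r) p (by linear_combination h) v
    rwa [neg_neg, neg_neg] at this
  · exact LinearMap.ext fun v => hinv p q r t h v
  · change op p q r t _ = _
    rw [hop]
    simp only [map_add, map_smul, hs, hu, smul_eq_mul, add_zero]
    ext
    · simp only
      ring
    · simp only
      module

/-- The substitution `T ↦ b T`. -/
noncomputable def scaleVar {R : Type*} [CommRing R] (b : R) : R[X] →ₐ[R] R[X] := aeval (C b * X)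

theorem coeff_scaleVar {R : Type*} [CommRing R] (b : R) (p : R[X]) (n : ℕ) :
    (scaleVar b p).coeff n = p.coeff n * b ^ n :=
  comp_C_mul_X_coeff

theorem scaleVar_C {R : Type*} [CommRing R] (b r : R) : scaleVar b (C r) = C r :=
  aeval_C _ _

theorem scaleVar_X {R : Type*} [CommRing R] (b : R) : scaleVar b X = C b * X :=
  aeval_X _

theorem scaleVar_one_apply {R : Type*} [CommRing R] (p : R[X]) : scaleVar 1 p = p := by
  ext n
  simp [coeff_scaleVar]

/-- The complete homogeneous polynomial `(y ^ n - x ^ n) / (y - x)`. -/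
def powDividedDiff {R : Type*} [CommRing R] (x y : R) : ℕ → R
  | 0 => 0
  | n + 1 => powDividedDiff x y n * y + x ^ n

theorem powDividedDiff_add {R : Type*} [CommRing R] (x y : R) (i j : ℕ) :
    powDividedDiff x y (i + j) = powDividedDiff x y i * y ^ j + x ^ i * powDividedDiff x y j := by
  induction j with
  | zero => simp [powDividedDiff]
  | succ j ih =>
    rw [← add_assoc, powDividedDiff, ih, powDividedDiff]
    ring

theorem sub_mul_powDividedDiff {R : Type*} [CommRing R] (x y : R) (n : ℕ) :
    (y - x) * powDividedDiff x y n = y ^ n - x ^ n := by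
  induction n with
  | zero => simp [powDividedDiff]
  | succ n ih =>
    rw [powDividedDiff, mul_add, ← mul_assoc, ih]
    ring

/-- The divided difference of `scaleVar b p` between `b = x` and `b = y`. -/
noncomputable def dividedDiff {R : Type*} [CommRing R] (x y : R) (p : R[X]) : R[X] :=
  ∑ i ∈ p.support, monomial i (p.coeff i * powDividedDiff x y i)

theorem coeff_dividedDiff {R : Type*} [CommRing R] (x y : R) (p : R[X]) (n : ℕ) :
    (dividedDiff x y p).coeff n = p.coeff n * powDividedDiff x y n := by
  classical
  simp only [dividedDiff, finsetSum_coeff, coeff_monomial, Finset.sum_ite_eq']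
  split_ifs with h
  · rfl
  · rw [notMem_support_iff.1 h, zero_mul]

theorem natDegree_dividedDiff_le {R : Type*} [CommRing R] (x y : R) (p : R[X]) :
    (dividedDiff x y p).natDegree ≤ p.natDegree := by
  rw [natDegree_le_iff_coeff_eq_zero]
  intro n hn
  rw [coeff_dividedDiff, coeff_eq_zero_of_natDegree_lt hn, zero_mul]

theorem scaleVar_eq_add {R : Type*} [CommRing R] (x y : R) (p : R[X]) :
    scaleVar y p = scaleVar x p + C (y - x) * dividedDiff x y p := by
  ext n
  rw [coeff_add, coeff_C_mul, coeff_scaleVar, coeff_scaleVar, coeff_dividedDiff, mul_left_comm,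
    sub_mul_powDividedDiff]
  ring

theorem dividedDiff_mul {R : Type*} [CommRing R] (x y : R) (p q : R[X]) :
    dividedDiff x y (p * q) =
      dividedDiff x y p * scaleVar y q + scaleVar x p * dividedDiff x y q := by
  ext n
  simp only [coeff_dividedDiff, coeff_add, coeff_mul, coeff_scaleVar]
  rw [Finset.sum_mul, ← Finset.sum_add_distrib]
  refine Finset.sum_congr rfl fun ij hij => ?_
  rw [← Finset.HasAntidiagonal.mem_antidiagonal.1 hij, powDividedDiff_add]
  ring

theorem dividedDiff_add {R : Type*} [CommRing R] (x y : R) (p q : R[X]) :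
    dividedDiff x y (p + q) = dividedDiff x y p + dividedDiff x y q := by
  ext n
  simp only [coeff_dividedDiff, coeff_add, add_mul]

theorem dividedDiff_C {R : Type*} [CommRing R] (x y r : R) : dividedDiff x y (C r) = 0 := by
  ext n
  rw [coeff_dividedDiff]
  cases n with
  | zero => simp [powDividedDiff]
  | succ n => simp

open Filter in
theorem eventually_forall_natDegree_le_mem {R : Type*} [CommRing R] {A : Subalgebra R R[X]} {s : R}
    (hsA : ∀ f : R[X], ∃ k : ℕ, (C s) ^ k * f ∈ A) (n : ℕ) :
    ∀ᶠ K in atTop, ∀ p : R[X], p.natDegree ≤ n → C (s ^ K) * p ∈ A := by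
  choose k hk using fun i : ℕ => hsA (X ^ i)
  filter_upwards [eventually_ge_atTop ((Finset.range (n + 1)).sup k)] with K hK p hp
  rw [p.as_sum_range' (n + 1) (by omega), Finset.mul_sum]
  refine A.sum_mem fun i hi => ?_
  have hKi : k i ≤ K := (Finset.le_sup hi).trans hK
  rw [← C_mul_X_pow_eq_monomial, ← Nat.sub_add_cancel hKi, pow_add]
  have : C (s ^ (K - k i) * s ^ k i) * (C (p.coeff i) * X ^ i) =
      C (s ^ (K - k i) * p.coeff i) * (C s ^ k i * X ^ i) := by
    simp only [C_mul, C_pow]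
    ring
  rw [this]
  exact A.mul_mem (A.algebraMap_mem _) (hk i)

open Filter in
theorem eventually_scaleVar_mem {R : Type*} [CommRing R] {A : Subalgebra R R[X]} {s : R}
    (hsA : ∀ f : R[X], ∃ k : ℕ, (C s) ^ k * f ∈ A) {p : R[X]} (hp : p ∈ A) :
    ∀ᶠ K in atTop, ∀ b : R, s ^ K ∣ b - 1 → scaleVar b p ∈ A := by
  filter_upwards [eventually_forall_natDegree_le_mem hsA p.natDegree] with K hK b hb
  obtain ⟨c, hc⟩ := hb
  rw [scaleVar_eq_add 1 b, scaleVar_one_apply, hc, C_mul, mul_assoc]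
  exact A.add_mem hp (hK _ ((natDegree_C_mul_le _ _).trans (natDegree_dividedDiff_le _ _ _)))

theorem dividedDiff_matrix_identities {R : Type*} [CommRing R] (x τ c : R) (f μ g₁ g₂ : R[X])
    (hc : f * g₁ + μ * g₂ = C c) :
    (let D := dividedDiff x (x + τ * c)
    let n₁₁ := D f * scaleVar x g₁ + D g₂ * scaleVar x μ
    let n₁₂ := D f * scaleVar x g₂ - D g₂ * scaleVar x f
    let n₂₁ := D μ * scaleVar x g₁ - D g₁ * scaleVar x μ
    let n₂₂ := D μ * scaleVar x g₂ + D g₁ * scaleVar x f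
    n₁₁ + n₂₂ + C τ * (n₁₁ * n₂₂ - n₁₂ * n₂₁) = 0 ∧
      scaleVar (x + τ * c) f = scaleVar x f + C τ * (n₁₁ * scaleVar x f + n₁₂ * scaleVar x μ) ∧
      scaleVar (x + τ * c) μ = scaleVar x μ + C τ * (n₂₁ * scaleVar x f + n₂₂ * scaleVar x μ)) := by
  intro D n₁₁ n₁₂ n₂₁ n₂₂
  have h1 : scaleVar x f * scaleVar x g₁ + scaleVar x μ * scaleVar x g₂ = C c := by
    rw [← map_mul, ← map_mul, ← map_add, hc, scaleVar_C]
  have h2 : D f * scaleVar (x + τ * c) g₁ + scaleVar x f * D g₁ +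
      (D μ * scaleVar (x + τ * c) g₂ + scaleVar x μ * D g₂) = 0 := by
    rw [← dividedDiff_mul, ← dividedDiff_mul, ← dividedDiff_add, hc, dividedDiff_C]
  have h3 : ∀ p, scaleVar (x + τ * c) p = scaleVar x p + C τ * C c * D p := by
    intro p
    rw [scaleVar_eq_add x, add_sub_cancel_left, C_mul]
  rw [h3, h3] at h2
  refine ⟨?_, ?_, ?_⟩
  · simp only [n₁₁, n₁₂, n₂₁, n₂₂]
    linear_combination h2 + C τ * (D f * D g₁ + D μ * D g₂) * h1
  · rw [h3]
    simp only [n₁₁, n₁₂]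
    linear_combination (-C τ * D f) * h1
  · rw [h3]
    simp only [n₂₁, n₂₂]
    linear_combination (-C τ * D μ) * h1

theorem eventually_mul_dividedDiff_mem {R : Type*} [CommRing R] {A : Subalgebra R R[X]} {s : R}
    (hsA : ∀ f : R[X], ∃ k : ℕ, (C s) ^ k * f ∈ A) (p : R[X]) :
    ∀ᶠ K in Filter.atTop, ∀ x y t : R, C (s ^ (K - 1) * t) * dividedDiff x y p ∈ A := by
  filter_upwards [(Filter.tendsto_sub_atTop_nat 1).eventually
    (eventually_forall_natDegree_le_mem hsA p.natDegree)] with K hK x y t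
  rw [C_mul, mul_assoc]
  exact hK _ ((natDegree_C_mul_le _ _).trans (natDegree_dividedDiff_le _ _ _))

open Filter in
theorem eventually_sameOrbit_scaleVar {R : Type*} [CommRing R] {A : Subalgebra R R[X]} {s : R}
    (hsA : ∀ f : R[X], ∃ k : ℕ, (C s) ^ k * f ∈ A)
    {M : Type*} [AddCommGroup M] [Module A M] (φ : M →ₗ[A] A) (x₀ : M)
    (hφ : φ x₀ = algebraMap R A s) (f μ g₁ g₂ : A) {c : R}
    (hc : (f : R[X]) * g₁ + (μ : R[X]) * g₂ = C c) :
    ∀ᶠ K in atTop, ∀ x t : R, s ^ K ∣ x - 1 → ∀ (F B F' B' : A) (u : M), φ u = 0 →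
      (F : R[X]) = scaleVar x f → (B : R[X]) = scaleVar x μ →
      (F' : R[X]) = scaleVar (x + s ^ K * t * c) f →
      (B' : R[X]) = scaleVar (x + s ^ K * t * c) μ →
      SameOrbit A (F, B • x₀ + u) (F', B' • x₀ + u) := by
  filter_upwards [eventually_mul_dividedDiff_mem hsA f,
    eventually_mul_dividedDiff_mem hsA μ, eventually_mul_dividedDiff_mem hsA g₁,
    eventually_mul_dividedDiff_mem hsA g₂, eventually_scaleVar_mem hsA g₁.2,
    eventually_scaleVar_mem hsA g₂.2, eventually_ge_atTop 1] with
    K hDf hDμ hDg₁ hDg₂ hg₁ hg₂ hK x t hx F B F' B' u hu hF hB hF' hB'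
  set y := x + s ^ K * t * c
  obtain ⟨h1, h2, h3⟩ := dividedDiff_matrix_identities x (s ^ K * t) c (f : R[X]) μ g₁ g₂ hc
  let Df : A := ⟨_, hDf x y t⟩
  let Dμ : A := ⟨_, hDμ x y t⟩
  let Dg₁ : A := ⟨_, hDg₁ x y t⟩
  let Dg₂ : A := ⟨_, hDg₂ x y t⟩
  let G₁ : A := ⟨_, hg₁ x hx⟩
  let G₂ : A := ⟨_, hg₂ x hx⟩
  have hsK : (C (s ^ K * t) : R[X]) = C s * C (s ^ (K - 1) * t) := by
    rw [← C_mul, ← mul_assoc, ← pow_succ', Nat.sub_add_cancel hK]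
  have h := sameOrbit_of_matrix φ x₀ (p := Df * G₁ + Dg₂ * B) (q := Df * G₂ - Dg₂ * F)
    (r := algebraMap R A s * (Dμ * G₁ - Dg₁ * B)) (t := Dμ * G₂ + Dg₁ * F) hφ (by
      apply Subtype.ext
      have : ((algebraMap R A s : A) : R[X]) = C s := rfl
      simp only [Subalgebra.coe_add, Subalgebra.coe_sub, Subalgebra.coe_mul, Df, Dμ, Dg₁, Dg₂, G₁, G₂,
        hF, hB, this, Subalgebra.coe_zero]
      rw [hsK] at h1
      linear_combination C (s ^ (K - 1) * t) * h1) F B u hu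
  have e1 : F + algebraMap R A s * ((Df * G₁ + Dg₂ * B) * F + (Df * G₂ - Dg₂ * F) * B) = F' := by
    apply Subtype.ext
    have : ((algebraMap R A s : A) : R[X]) = C s := rfl
    simp only [Subalgebra.coe_add, Subalgebra.coe_sub, Subalgebra.coe_mul, Df, Dg₂, G₁, G₂,
      hF, hB, this, hF']
    rw [h2, hsK]
    ring
  have e2 : B + algebraMap R A s * (Dμ * G₁ - Dg₁ * B) * F +
      algebraMap R A s * ((Dμ * G₂ + Dg₁ * F) * B) = B' := by
    apply Subtype.ext
    have : ((algebraMap R A s : A) : R[X]) = C s := rfl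
    simp only [Subalgebra.coe_add, Subalgebra.coe_sub, Subalgebra.coe_mul, Dμ, Dg₁, G₁, G₂,
      hF, hB, this, hB']
    rw [h3, hsK]
    ring
  rwa [e1, e2] at h

open Classical in
/-- The substitution `T ↦ b T` on a subring of `R[T]`, where the result is in the subring. -/
noncomputable def scaleIn {R : Type*} [CommRing R] (A : Subalgebra R R[X]) (b : R) (p : A) : A :=
  if h : scaleVar b (p : R[X]) ∈ A then ⟨_, h⟩ else 0

theorem coe_scaleIn {R : Type*} [CommRing R] {A : Subalgebra R R[X]} {b : R} {p : A}
    (h : scaleVar b (p : R[X]) ∈ A) : (scaleIn A b p : R[X]) = scaleVar b (p : R[X]) := by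
  rw [scaleIn, dif_pos h]

/-- The vector `(f, ∑ μ j • x j)` after the substitution `T ↦ b T` in its coordinates. -/
noncomputable def scaleVec {R : Type*} [CommRing R] (A : Subalgebra R R[X]) {M : Type*}
    [AddCommGroup M] [Module A M] (x : ℕ → M) (N : ℕ) (f : A) (μ : ℕ → A) (b : R) : A × M :=
  (scaleIn A b f, ∑ j ∈ Finset.range (N + 1), scaleIn A b (μ j) • x j)

open Filter in
/-- The elements `c` of `R` such that the orbit of `scaleVec A x N f μ b` only depends on `b`
modulo `c`. -/
def scaleIdeal {R : Type*} [CommRing R] (A : Subalgebra R R[X]) {M : Type*}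
    [AddCommGroup M] [Module A M] (x : ℕ → M) (N : ℕ) (f : A) (μ : ℕ → A) (s : R) : Ideal R where
  carrier := {c | ∀ᶠ K in atTop, ∀ b t : R, s ^ K ∣ b - 1 →
    SameOrbit A (scaleVec A x N f μ b) (scaleVec A x N f μ (b + s ^ K * t * c))}
  zero_mem' := by
    refine Eventually.of_forall fun K b t _ => ?_
    rw [mul_zero, add_zero]
    exact SameOrbit.refl _
  add_mem' := by
    intro c c' hc hc'
    filter_upwards [hc, hc'] with K h h' b t hb
    rw [mul_add, ← add_assoc]
    refine (h b t hb).trans (h' _ t ?_)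
    rw [add_sub_right_comm, mul_assoc]
    exact dvd_add hb (dvd_mul_right _ _)
  smul_mem' := by
    intro a c hc
    filter_upwards [hc] with K h b t hb
    rw [smul_eq_mul, ← mul_assoc, mul_assoc _ t a]
    exact h b _ hb

open Filter in
theorem mem_scaleIdeal {R : Type*} [CommRing R] {A : Subalgebra R R[X]} {s : R}
    (hsA : ∀ f : R[X], ∃ k : ℕ, (C s) ^ k * f ∈ A)
    {M : Type*} [AddCommGroup M] [Module A M] {x : ℕ → M} {φ : ℕ → M →ₗ[A] A} {r : ℕ → R} {N : ℕ}
    (hφ : ∀ i j, φ i (x j) = if i = j then algebraMap R A (r i) else 0) (hr : r 0 = s)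
    (f : A) {μ : ℕ → A} (hμ : ∀ j, algebraMap R A (r j) * μ j = algebraMap R A s * μ j)
    (y : ℕ → A) (g₁ g₂ : A) {c : R}
    (hc : f * g₁ + (μ 0 + ∑ j ∈ Finset.range N, algebraMap R A s * y j * μ (j + 1)) * g₂ =
      algebraMap R A c) : c ∈ scaleIdeal A x N f μ s := by
  set f₂ := μ 0 + ∑ j ∈ Finset.range N, algebraMap R A s * y j * μ (j + 1) with hf₂
  have hcoe : ∀ a : R, ((algebraMap R A a : A) : R[X]) = C a := fun _ => rfl
  have hμb : ∀ b j, scaleVar b (μ j : R[X]) ∈ A →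
      algebraMap R A (r j) * scaleIn A b (μ j) = algebraMap R A s * scaleIn A b (μ j) := by
    intro b j hb
    apply Subtype.ext
    have := congrArg (fun a : A => scaleVar b (a : R[X])) (hμ j)
    simpa only [Subalgebra.coe_mul, hcoe, map_mul, scaleVar_C, coe_scaleIn hb] using this
  have hfin : ∀ {p : ℕ → A}, ∀ᶠ K in atTop, ∀ j ∈ Finset.range (N + 1), ∀ b : R, s ^ K ∣ b - 1 →
      scaleVar b (p j : R[X]) ∈ A := fun {p} =>
    (Filter.eventually_all_finset _).2 fun j _ => eventually_scaleVar_mem hsA (p j).2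
  have hfinD : ∀ᶠ K in atTop, ∀ j ∈ Finset.range (N + 1), ∀ x y t : R,
      C (s ^ (K - 1) * t) * dividedDiff x y (μ j : R[X]) ∈ A :=
    (Filter.eventually_all_finset _).2 fun j _ => eventually_mul_dividedDiff_mem hsA _
  change ∀ᶠ K in atTop, _
  filter_upwards [eventually_sameOrbit_scaleVar hsA (φ 0) (x 0) (by rw [hφ, if_pos rfl, hr]) f f₂
    g₁ g₂ (c := c) (congrArg Subtype.val hc), eventually_scaleVar_mem hsA f.2,
    eventually_scaleVar_mem hsA f₂.2,
    eventually_scaleVar_mem hsA g₁.2, eventually_scaleVar_mem hsA g₂.2, hfin (p := μ),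
    hfin (p := y), hfinD, eventually_ge_atTop 1] with K hK hKf hKf₂ hKg₁ hKg₂ hKμ hKy hKD hK1 b t hb
  have hb' : s ^ K ∣ b + s ^ K * t * c - 1 := by
    rw [add_sub_right_comm, mul_assoc]
    exact dvd_add hb (dvd_mul_right _ _)
  set b' := b + s ^ K * t * c with hb'def
  have hshift : ∀ b, s ^ K ∣ b - 1 → SameOrbit A (scaleVec A x N f μ b)
      (scaleIn A b f, scaleIn A b f₂ • x 0 +
        ∑ j ∈ Finset.range N, scaleIn A b (μ (j + 1)) • x (j + 1)) := by
    intro b hb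
    have hval : ∀ j ∈ Finset.range N,
        φ (j + 1) (∑ i ∈ Finset.range (N + 1), scaleIn A b (μ i) • x i) =
          algebraMap R A s * scaleIn A b (μ (j + 1)) := by
      intro j hj
      have hj' : j + 1 ∈ Finset.range (N + 1) := by simpa using hj
      rw [← hμb b _ (hKμ _ hj' b hb), map_sum, Finset.sum_eq_single (j + 1)]
      · rw [map_smul, hφ, if_pos rfl, smul_eq_mul, mul_comm]
      · intro i _ hij
        rw [map_smul, hφ, if_neg hij.symm, smul_zero]
      · exact fun h => absurd hj' h
    have hf₂b : scaleIn A b f₂ = scaleIn A b (μ 0) + ∑ j ∈ Finset.range N,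
        scaleIn A b (y j) * (algebraMap R A s * scaleIn A b (μ (j + 1))) := by
      apply Subtype.ext
      rw [Subalgebra.coe_add, coe_scaleIn (hKf₂ b hb), coe_scaleIn (hKμ 0 (by simp) b hb), hf₂,
        Subalgebra.coe_add, map_add, AddSubmonoidClass.coe_finsetSum,
        AddSubmonoidClass.coe_finsetSum, map_sum]
      congr 1
      refine Finset.sum_congr rfl fun j hj => ?_
      simp only [Finset.mem_range] at hj
      simp only [Subalgebra.coe_mul, hcoe, map_mul, scaleVar_C]
      rw [coe_scaleIn (hKy j (by simp; omega) b hb),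
        coe_scaleIn (hKμ (j + 1) (by simpa using hj) b hb)]
      ring
    have h := sameOrbit_add_smul
      ((∑ j ∈ Finset.range N, scaleIn A b (y j) • φ (j + 1)) ∘ₗ LinearMap.snd A A M)
      (w := ((0 : A), x 0)) (by simp [hφ]) (scaleVec A x N f μ b)
    convert h using 1
    have hψ : ((∑ j ∈ Finset.range N, scaleIn A b (y j) • φ (j + 1)) ∘ₗ LinearMap.snd A A M)
        (scaleVec A x N f μ b) = ∑ j ∈ Finset.range N,
          scaleIn A b (y j) * (algebraMap R A s * scaleIn A b (μ (j + 1))) := by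
      rw [scaleVec, LinearMap.comp_apply, LinearMap.snd_apply, LinearMap.sum_apply]
      refine Finset.sum_congr rfl fun j hj => ?_
      rw [LinearMap.smul_apply, hval j hj, smul_eq_mul]
    rw [hψ, scaleVec, Finset.sum_range_succ', hf₂b]
    ext
    · simp
    · simp only [Prod.snd_add, Prod.smul_snd]
      rw [add_smul]
      abel
  refine (hshift b hb).trans (SameOrbit.trans ?_ (hshift b' hb').symm)
  refine (hK b t hb _ _ (scaleIn A b' f) (scaleIn A b' f₂) _ ?_ (coe_scaleIn (hKf b hb))
    (coe_scaleIn (hKf₂ b hb)) (coe_scaleIn (hKf b' hb')) (coe_scaleIn (hKf₂ b' hb'))).trans ?_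
  · simp [hφ]
  · have hω : ∀ j ∈ Finset.range N, ∃ ω : A, scaleIn A b' (μ (j + 1)) =
        scaleIn A b (μ (j + 1)) + (algebraMap R A s * algebraMap R A c) * ω := by
      intro j hj
      have hj' : j + 1 ∈ Finset.range (N + 1) := by simpa using hj
      refine ⟨⟨_, hKD _ hj' b b' t⟩, Subtype.ext ?_⟩
      rw [coe_scaleIn (hKμ _ hj' b' hb'), Subalgebra.coe_add, Subalgebra.coe_mul,
        coe_scaleIn (hKμ _ hj' b hb), Subalgebra.coe_mul, hcoe, hcoe, scaleVar_eq_add b b',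
        hb'def, add_sub_cancel_left, ← hb'def, ← mul_assoc, ← C_mul, ← C_mul,
        ← Nat.sub_add_cancel hK1, Nat.add_sub_cancel, pow_succ]
      congr 3
      ring
    choose! ω hω using hω
    have hval : (algebraMap R A s * scaleIn A b' g₁) * scaleIn A b' f +
        scaleIn A b' g₂ * (scaleIn A b' f₂ * algebraMap R A s) =
        algebraMap R A s * algebraMap R A c := by
      apply Subtype.ext
      have := congrArg (fun a : A => scaleVar b' (a : R[X])) hc
      simp only [Subalgebra.coe_mul, Subalgebra.coe_add, map_add, map_mul, scaleVar_C,
        hcoe] at this ⊢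
      rw [coe_scaleIn (hKf b' hb'), coe_scaleIn (hKf₂ b' hb'), coe_scaleIn (hKg₁ b' hb'),
        coe_scaleIn (hKg₂ b' hb')]
      linear_combination (C s) * this
    have h := sameOrbit_add_smul
      ((algebraMap R A s * scaleIn A b' g₁) • LinearMap.fst A A M +
        (scaleIn A b' g₂ • φ 0) ∘ₗ LinearMap.snd A A M)
      (w := ((0 : A), ∑ j ∈ Finset.range N, ω j • x (j + 1))) (by simp [hφ])
      (scaleIn A b' f, scaleIn A b' f₂ • x 0 +
        ∑ j ∈ Finset.range N, scaleIn A b (μ (j + 1)) • x (j + 1))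
    convert h using 1
    have hval' : ((algebraMap R A s * scaleIn A b' g₁) • LinearMap.fst A A M +
        (scaleIn A b' g₂ • φ 0) ∘ₗ LinearMap.snd A A M)
        (scaleIn A b' f, scaleIn A b' f₂ • x 0 +
        ∑ j ∈ Finset.range N, scaleIn A b (μ (j + 1)) • x (j + 1)) =
        algebraMap R A s * algebraMap R A c := by
      rw [← hval]
      simp [hφ, hr]
    rw [hval']
    ext
    · simp
    · simp only [Prod.snd_add, Prod.smul_snd]
      rw [add_assoc, Finset.smul_sum, ← Finset.sum_add_distrib]
      congr 1
      refine Finset.sum_congr rfl fun j hj => ?_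
      rw [hω j hj, add_smul, mul_smul]

theorem exists_isCoprime_add_mul {B : Type*} [CommRing B] [IsDomain B] [IsPrincipalIdealRing B]
    {f μ z a b e : B} (hf : f ≠ 0) (h : a * f + b * μ + e * z = 1) :
    ∃ w : B, ∀ u, IsUnit u → IsCoprime f (μ + u * w * z) := by
  classical
  refine ⟨((UniqueFactorizationMonoid.factors f).filter fun q => ¬ q ∣ μ).prod, fun u hu => ?_⟩
  refine isCoprime_of_prime_dvd (fun h0 => hf h0.1) fun q hq hqf hq2 => ?_
  by_cases hqμ : q ∣ μ
  · rw [dvd_add_right hqμ] at hq2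
    rcases hq.dvd_or_dvd hq2 with h1 | h1
    · rcases hq.dvd_or_dvd h1 with h2 | h2
      · exact hq.not_isUnit (isUnit_of_dvd_unit h2 hu)
      · obtain ⟨q', hq', hqq'⟩ := hq.exists_mem_multiset_dvd h2
        rw [Multiset.mem_filter] at hq'
        have h3 : Associated q q' := hq.irreducible.associated_of_dvd
          (UniqueFactorizationMonoid.irreducible_of_factor _ hq'.1) hqq'
        exact hq'.2 (h3.dvd_iff_dvd_left.1 hqμ)
    · refine hq.not_dvd_one (h ▸ ?_)
      exact dvd_add (dvd_add (hqf.mul_left _) (hqμ.mul_left _)) (h1.mul_left _)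
  · obtain ⟨q', hq', hqq'⟩ :=
      UniqueFactorizationMonoid.exists_mem_factors_of_dvd hf hq.irreducible hqf
    refine hqμ ((dvd_add_left ?_).1 hq2)
    refine Dvd.dvd.mul_right (Dvd.dvd.mul_left (hqq'.dvd.trans (Multiset.dvd_prod ?_)) _) _
    exact Multiset.mem_filter.2 ⟨hq', fun h' => hqμ (hqq'.dvd.trans h')⟩

theorem exists_mul_add_mul_eq_C_of_isCoprime_map {R : Type*} [CommRing R] (p : Ideal R) [p.IsPrime]
    (f₁ f₂ : R[X]) (hf₁ : f₁.leadingCoeff ∉ p)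
    (h : IsCoprime (f₁.map (algebraMap R p.ResidueField)) (f₂.map (algebraMap R p.ResidueField))) :
    ∃ c ∉ p, ∃ g₁ g₂, f₁ * g₁ + f₂ * g₂ = C c := by
  obtain ⟨g₁, g₂, -, -, hg⟩ := exists_mul_add_mul_eq_C_resultant (m := f₁.natDegree)
    (n := f₂.natDegree + 1) f₁ f₂ le_rfl (Nat.le_succ _) (Or.inr (Nat.succ_ne_zero _))
  refine ⟨_, ?_, g₁, g₂, hg⟩
  rw [← Ideal.algebraMap_residueField_eq_zero, ← resultant_map_map]
  set K := p.ResidueField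
  have hlead : algebraMap R K f₁.leadingCoeff ≠ 0 := by
    rwa [Ne, Ideal.algebraMap_residueField_eq_zero]
  have hdeg : (f₁.map (algebraMap R K)).natDegree = f₁.natDegree :=
    natDegree_map_of_leadingCoeff_ne_zero _ hlead
  obtain ⟨k, hk⟩ := Nat.exists_eq_add_of_le
    ((natDegree_map_le (f := algebraMap R K) (p := f₂)).trans (Nat.le_succ _))
  rw [Nat.succ_eq_add_one] at hk
  rw [hk, ← hdeg, resultant_add_right_deg _ _ _ _ _ le_rfl, hdeg, coeff_map]
  refine mul_ne_zero (pow_ne_zero _ hlead) ?_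
  rw [← hdeg]
  exact resultant_ne_zero _ _ h

theorem exists_map_residueField_eq_C_mul {R : Type*} [CommRing R] (p : Ideal R) [p.IsPrime]
    (w : p.ResidueField[X]) :
    ∃ t ∉ p, ∃ W : R[X], W.map (algebraMap R p.ResidueField) =
      C (algebraMap R p.ResidueField t) * w := by
  obtain ⟨b, hb, hbw⟩ := IsLocalization.integerNormalization_spec (nonZeroDivisors (R ⧸ p)) w
  obtain ⟨t, rfl⟩ := Ideal.Quotient.mk_surjective b
  obtain ⟨W, hW⟩ := Polynomial.map_surjective _ Ideal.Quotient.mk_surjective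
    (IsLocalization.integerNormalization (nonZeroDivisors (R ⧸ p)) w)
  refine ⟨t, fun ht => nonZeroDivisors.ne_zero hb (Ideal.Quotient.eq_zero_iff_mem.2 ht), W, ?_⟩
  rw [IsScalarTower.algebraMap_eq R (R ⧸ p) p.ResidueField, ← Polynomial.map_map]
  rw [show algebraMap R (R ⧸ p) = Ideal.Quotient.mk p from rfl, hW, hbw]
  ext n
  rw [coeff_C_mul, coeff_smul, Algebra.smul_def]
  rfl

theorem exists_notMem_mem_scaleIdeal {R : Type*} [CommRing R] {A : Subalgebra R R[X]} {s : R}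
    (hsA : ∀ f : R[X], ∃ k : ℕ, (C s) ^ k * f ∈ A)
    {M : Type*} [AddCommGroup M] [Module A M] {x : ℕ → M} {φ : ℕ → M →ₗ[A] A} {r : ℕ → R} {N : ℕ}
    (hφ : ∀ i j, φ i (x j) = if i = j then algebraMap R A (r i) else 0) (hr : r 0 = s)
    (f : A) {μ : ℕ → A} (hμ : ∀ j, algebraMap R A (r j) * μ j = algebraMap R A s * μ j)
    {k : ℕ} (hf : (f : R[X]).leadingCoeff = s ^ k) (a : A) (η : ℕ → A)
    (hum : a * f + ∑ j ∈ Finset.range (N + 1), η j * μ j = 1)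
    (p : Ideal R) (hp : p.IsPrime) (hsp : s ∉ p) : ∃ c ∉ p, c ∈ scaleIdeal A x N f μ s := by
  set K := p.ResidueField
  have hs0 : algebraMap R K s ≠ 0 := by rwa [Ne, Ideal.algebraMap_residueField_eq_zero]
  have hlead : (f : R[X]).leadingCoeff ∉ p := fun h => hsp (hp.mem_of_pow_mem _ (hf ▸ h))
  let π : A →+* K[X] := (mapRingHom (algebraMap R K)).comp A.val.toRingHom
  have hπ : ∀ a : A, π a = (a : R[X]).map (algebraMap R K) := fun _ => rfl
  have hπC : ∀ t : R, π (algebraMap R A t) = C (algebraMap R K t) := fun t => map_C _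
  set z := ∑ j ∈ Finset.range N, η (j + 1) * μ (j + 1)
  have hf0 : π f ≠ 0 := by
    intro h
    have := congrArg (fun q : K[X] => q.coeff (f : R[X]).natDegree) h
    simp only [hπ, coeff_map, coeff_zero, coeff_natDegree] at this
    exact hlead (Ideal.algebraMap_residueField_eq_zero.1 this)
  obtain ⟨w, hw⟩ := exists_isCoprime_add_mul (f := π f) (μ := π (μ 0)) (z := π z) (a := π a)
    (b := π (η 0)) (e := 1) hf0 (by
      rw [Finset.sum_range_succ'] at hum
      rw [one_mul, ← map_mul, ← map_mul, ← map_add, ← map_add, ← map_one π, ← hum]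
      congr 1
      ring)
  obtain ⟨t, ht, W, hW⟩ := exists_map_residueField_eq_C_mul p w
  obtain ⟨l, hl⟩ := hsA W
  let W' : A := ⟨_, hl⟩
  have hπW' : π W' = C (algebraMap R K (s ^ l * t)) * w := by
    rw [hπ, Polynomial.map_mul, hW, Polynomial.map_pow, map_C, map_mul, map_pow, C_mul, C_pow, mul_assoc]
  set f₂ : A := μ 0 + ∑ j ∈ Finset.range N, algebraMap R A s * (W' * η (j + 1)) * μ (j + 1)
  have hf₂ : f₂ = μ 0 + algebraMap R A s * W' * z := by
    simp only [f₂, z, Finset.mul_sum]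
    congr 1
    exact Finset.sum_congr rfl fun _ _ => by ring
  have hcop : IsCoprime (π f) (π f₂) := by
    have ht0 : algebraMap R K t ≠ 0 := by rwa [Ne, Ideal.algebraMap_residueField_eq_zero]
    have := hw (C (algebraMap R K (s * (s ^ l * t))))
      (isUnit_C.2 (IsUnit.mk0 _ (by simp only [map_mul, map_pow]; positivity)))
    rwa [hf₂, map_add, map_mul, map_mul, hπW', hπC, ← mul_assoc (C _), ← C_mul, ← map_mul]
  obtain ⟨c, hc, g₁, g₂, hg⟩ := exists_mul_add_mul_eq_C_of_isCoprime_map p (f : R[X]) f₂ hlead hcop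
  obtain ⟨k₁, hk₁⟩ := hsA g₁
  obtain ⟨k₂, hk₂⟩ := hsA g₂
  have h1 := mem_scaleIdeal hsA hφ hr f hμ (fun j => W' * η (j + 1))
    (algebraMap R A (s ^ k₂) * ⟨_, hk₁⟩) (algebraMap R A (s ^ k₁) * ⟨_, hk₂⟩) (N := N)
    (c := s ^ k₁ * s ^ k₂ * c) (by
      apply Subtype.ext
      change (f : R[X]) * (C (s ^ k₂) * (C s ^ k₁ * g₁)) +
        (f₂ : R[X]) * (C (s ^ k₁) * (C s ^ k₂ * g₂)) = C (s ^ k₁ * s ^ k₂ * c)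
      rw [C_mul, ← hg, C_mul, C_pow, C_pow]
      ring)
  refine ⟨_, fun h => ?_, h1⟩
  rcases hp.mem_or_mem h with h | h
  · rcases hp.mem_or_mem h with h | h <;> exact hsp (hp.mem_of_pow_mem _ h)
  · exact hc h

theorem exists_pow_mem_scaleIdeal {R : Type*} [CommRing R] {A : Subalgebra R R[X]} {s : R}
    (hsA : ∀ f : R[X], ∃ k : ℕ, (C s) ^ k * f ∈ A)
    {M : Type*} [AddCommGroup M] [Module A M] {x : ℕ → M} {φ : ℕ → M →ₗ[A] A} {r : ℕ → R} {N : ℕ}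
    (hφ : ∀ i j, φ i (x j) = if i = j then algebraMap R A (r i) else 0) (hr : r 0 = s)
    (f : A) {μ : ℕ → A} (hμ : ∀ j, algebraMap R A (r j) * μ j = algebraMap R A s * μ j)
    {k : ℕ} (hf : (f : R[X]).leadingCoeff = s ^ k) (a : A) (η : ℕ → A)
    (hum : a * f + ∑ j ∈ Finset.range (N + 1), η j * μ j = 1) :
    ∃ l, s ^ l ∈ scaleIdeal A x N f μ s := by
  rw [← Ideal.mem_radical_iff, Ideal.radical_eq_sInf, Ideal.mem_sInf]
  rintro p ⟨hle, hp⟩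
  by_contra hsp
  obtain ⟨c, hc, hcI⟩ := exists_notMem_mem_scaleIdeal hsA hφ hr f hμ hf a η hum p hp hsp
  exact hc (hle hcI)

theorem sameOrbit_scaleVec_of_mul_sub_one_eq {R : Type*} [CommRing R] {A : Subalgebra R R[X]}
    {s : R}
    {M : Type*} [AddCommGroup M] [Module A M] {x : ℕ → M} {φ : ℕ → M →ₗ[A] A} {r : ℕ → R} {N : ℕ}
    (hφ : ∀ i j, φ i (x j) = if i = j then algebraMap R A (r i) else 0)
    {H h f : A} {c : R} (hH : (H : R[X]) = C c * X) (hHnzd : H ∈ nonZeroDivisors A)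
    (hf : f = 1 + H * h) {ν : ℕ → A}
    (hν : ∀ j, algebraMap R A (r j) * ν j = algebraMap R A s * ν j) {m : M}
    (hm : m = ∑ j ∈ Finset.range (N + 1), (H * ν j) • x j)
    {b : R} (φ₀ : M →ₗ[A] A) (hb : algebraMap R A b * (f - 1) = φ₀ m) (κ : ℕ → A)
    (hκ : ∀ j ∈ Finset.range (N + 1),
      C s * (κ j : R[X]) = scaleVar b (φ₀ (x j) : R[X]) - (φ₀ (x j) : R[X]))
    (hbh : scaleVar b (h : R[X]) ∈ A)
    (hbν : ∀ j ∈ Finset.range (N + 1), scaleVar b (ν j : R[X]) ∈ A) :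
    SameOrbit A ((1 : A), (0 : M)) (scaleVec A x N f (fun j => H * ν j) b) := by
  have hcoe : ∀ a : R, ((algebraMap R A a : A) : R[X]) = C a := fun _ => rfl
  have hHb : scaleVar b (H : R[X]) = C b * H := by
    rw [hH, map_mul, scaleVar_C, scaleVar_X]; ring
  have hHν : ∀ j ∈ Finset.range (N + 1),
      scaleIn A b (H * ν j) = algebraMap R A b * (H * scaleIn A b (ν j)) := by
    intro j hj
    have h1 : scaleVar b ((H * ν j : A) : R[X]) =
        (algebraMap R A b * (H * scaleIn A b (ν j)) : A) := by
      rw [Subalgebra.coe_mul, Subalgebra.coe_mul, Subalgebra.coe_mul, map_mul, hHb, hcoe,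
        coe_scaleIn (hbν j hj), mul_assoc]
    apply Subtype.ext
    rw [coe_scaleIn (h1 ▸ Subtype.prop _), h1]
  have hfb : scaleIn A b f = 1 + algebraMap R A b * (H * scaleIn A b h) := by
    have h1 : scaleVar b (f : R[X]) = (1 + algebraMap R A b * (H * scaleIn A b h) : A) := by
      rw [hf, Subalgebra.coe_add, Subalgebra.coe_mul, Subalgebra.coe_add, Subalgebra.coe_mul,
        Subalgebra.coe_mul, map_add, map_mul, hHb, hcoe, coe_scaleIn hbh, mul_assoc,
        Subalgebra.coe_one, map_one]
    apply Subtype.ext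
    rw [coe_scaleIn (h1 ▸ Subtype.prop _), h1]
  set θ : M →ₗ[A] A := φ₀ + ∑ j ∈ Finset.range (N + 1), κ j • φ j with hθ
  set y : M := ∑ j ∈ Finset.range (N + 1), scaleIn A b (ν j) • x j with hy
  have hsum : ∑ j ∈ Finset.range (N + 1), ν j * φ₀ (x j) = algebraMap R A b * h := by
    have : H * ∑ j ∈ Finset.range (N + 1), ν j * φ₀ (x j) = H * (algebraMap R A b * h) := by
      rw [hm, hf] at hb
      simp only [map_sum, map_smul, smul_eq_mul, mul_assoc] at hb
      rw [Finset.mul_sum, ← hb]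
      ring
    exact (mul_cancel_left_mem_nonZeroDivisors hHnzd).1 this
  have hθy : θ y = algebraMap R A b * scaleIn A b h := by
    have h1 : ∀ j ∈ Finset.range (N + 1), scaleIn A b (ν j) * θ (x j) =
        scaleIn A b (ν j) * (φ₀ (x j) + algebraMap R A s * κ j) := by
      intro j hj
      have h2 : θ (x j) = φ₀ (x j) + κ j * algebraMap R A (r j) := by
        rw [hθ, LinearMap.add_apply, LinearMap.sum_apply, Finset.sum_eq_single j]
        · rw [LinearMap.smul_apply, hφ, if_pos rfl, smul_eq_mul]
        · intro i _ hij
          rw [LinearMap.smul_apply, hφ, if_neg hij, smul_zero]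
        · exact fun h => absurd hj h
      have h3 : algebraMap R A (r j) * scaleIn A b (ν j) =
          algebraMap R A s * scaleIn A b (ν j) := by
        apply Subtype.ext
        have := congrArg (fun a : A => scaleVar b (a : R[X])) (hν j)
        simpa only [Subalgebra.coe_mul, hcoe, map_mul, scaleVar_C, coe_scaleIn (hbν j hj)] using this
      rw [h2]
      linear_combination κ j * h3
    rw [hy, map_sum]
    simp only [map_smul, smul_eq_mul]
    rw [Finset.sum_congr rfl h1]
    apply Subtype.ext
    have h4 := congrArg (fun a : A => scaleVar b (a : R[X])) hsum
    simp only [AddSubmonoidClass.coe_finsetSum, Subalgebra.coe_mul, hcoe, map_mul, map_sum,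
      scaleVar_C] at h4
    rw [AddSubmonoidClass.coe_finsetSum, Subalgebra.coe_mul, hcoe, coe_scaleIn hbh, ← h4]
    refine Finset.sum_congr rfl fun j hj => ?_
    rw [Subalgebra.coe_mul, Subalgebra.coe_add, Subalgebra.coe_mul, hcoe, hκ j hj,
      coe_scaleIn (hbν j hj)]
    ring
  let ψ : A × M →ₗ[A] A := algebraMap R A b • LinearMap.fst A A M - θ ∘ₗ LinearMap.snd A A M
  have hψ : ∀ v, ψ v = algebraMap R A b * v.1 - θ v.2 := fun _ => rfl
  have key := sameOrbit_add_smul ψ (w := H • (scaleIn A b h, y)) (by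
    rw [map_smul, hψ, hθy, sub_self, smul_zero]) ((1 : A), (0 : M))
  convert key using 1
  rw [hψ, map_zero, sub_zero, mul_one]
  refine Prod.ext ?_ ?_
  · simp only [scaleVec, hfb, Prod.fst_add, Prod.smul_fst, smul_eq_mul]
  · simp only [scaleVec, Prod.snd_add, Prod.smul_snd, zero_add, hy, Finset.smul_sum, smul_smul]
    exact Finset.sum_congr rfl fun j hj => by rw [hHν j hj, mul_assoc]

theorem sameOrbit_one_zero_of_leadingCoeff {R : Type*} [CommRing R] {A : Subalgebra R R[X]} {s : R}
    (hsA : ∀ f : R[X], ∃ k : ℕ, (C s) ^ k * f ∈ A)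
    {M : Type*} [AddCommGroup M] [Module A M] {x : ℕ → M} {φ : ℕ → M →ₗ[A] A} {r : ℕ → R} {N : ℕ}
    (hφ : ∀ i j, φ i (x j) = if i = j then algebraMap R A (r i) else 0) (hr : r 0 = s)
    {H h f : A} {c : R} (hH : (H : R[X]) = C c * X) (hHnzd : H ∈ nonZeroDivisors A)
    (hf : f = 1 + H * h) {k : ℕ} (hlead : (f : R[X]).leadingCoeff = s ^ k) {ν : ℕ → A}
    (hν : ∀ j, algebraMap R A (r j) * ν j = algebraMap R A s * ν j) {m : M}
    (hm : m = ∑ j ∈ Finset.range (N + 1), (H * ν j) • x j)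
    (hum : ∃ (a : A) (θ : M →ₗ[A] A), a * f + θ m = 1) {b : R} (hb : s ∣ b - 1)
    (φ₀ : M →ₗ[A] A) (hφ₀ : algebraMap R A b * (f - 1) = φ₀ m) :
    SameOrbit A (f, m) ((1 : A), (0 : M)) := by
  obtain ⟨a, θ, haθ⟩ := hum
  obtain ⟨l, hl⟩ := exists_pow_mem_scaleIdeal hsA hφ hr f (μ := fun j => H * ν j) (N := N)
    (fun j => by linear_combination H * hν j) hlead a (fun j => θ (x j)) (by
      rw [← haθ, hm, map_sum]
      congr 1
      exact Finset.sum_congr rfl fun j _ => by rw [map_smul, smul_eq_mul, mul_comm])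
  have hl' : ∀ᶠ K in Filter.atTop, _ := hl
  obtain ⟨K, h1, hKh, hKν, hKη, hK0⟩ := (hl'.and ((eventually_scaleVar_mem hsA h.2).and
    (((Filter.eventually_all_finset (Finset.range (N + 1))).2 fun j _ =>
      eventually_scaleVar_mem hsA (ν j).2).and
    (((Filter.eventually_all_finset (Finset.range (N + 1))).2 fun j _ =>
      eventually_mul_dividedDiff_mem hsA (φ₀ (x j) : R[X])).and
        (Filter.eventually_gt_atTop 0))))).exists
  obtain ⟨e, he⟩ := hb
  obtain ⟨q, hq⟩ : b ∣ 1 - (1 - b) ^ (K + l) := by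
    have := sub_dvd_pow_sub_pow 1 (1 - b) (K + l)
    rwa [one_pow, sub_sub_cancel] at this
  set β := 1 - (1 - b) ^ (K + l) with hβ
  have hβ' : β = 1 + s ^ K * -(-e) ^ (K + l) * s ^ l := by
    rw [hβ, ← neg_sub b 1, he, ← mul_neg, mul_pow, pow_add s]
    ring
  have hβK : s ^ K ∣ β - 1 := ⟨-(-e) ^ (K + l) * s ^ l, by rw [hβ']; ring⟩
  have h2 := h1 1 (-(-e) ^ (K + l)) (by simp)
  rw [← hβ'] at h2
  have h3 : scaleVec A x N f (fun j => H * ν j) 1 = (f, m) := by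
    have : ∀ p : A, scaleIn A 1 p = p := fun p => by
      apply Subtype.ext
      rw [coe_scaleIn] <;> rw [scaleVar_one_apply]
      exact p.2
    simp only [scaleVec, this, hm]
  rw [h3] at h2
  refine h2.trans (SameOrbit.symm ?_)
  have hc : ∀ t : R, ((algebraMap R A t : A) : R[X]) = C t := fun _ => rfl
  let t := -(-e) ^ (K + l) * s ^ l
  have ht : β - 1 = s * (s ^ (K - 1) * t) := by
    rw [hβ', ← mul_assoc, ← pow_succ', Nat.sub_add_cancel hK0]
    ring
  refine sameOrbit_scaleVec_of_mul_sub_one_eq hφ hH hHnzd hf hν hm (algebraMap R A q • φ₀) ?_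
    (fun j => if hj : j ∈ Finset.range (N + 1) then
      algebraMap R A q * ⟨_, hKη j hj 1 β t⟩ else 0) ?_
    (hKh _ hβK) (fun j hj => hKν j hj _ hβK)
  · rw [hq, LinearMap.smul_apply, ← hφ₀, map_mul, smul_eq_mul]
    ring
  · intro j hj
    rw [dif_pos hj, LinearMap.smul_apply, smul_eq_mul, Subalgebra.coe_mul, Subalgebra.coe_mul, hc,
      map_mul (scaleVar β), scaleVar_C, scaleVar_eq_add 1 β, scaleVar_one_apply, ht, C_mul (a := s)]
    ring

theorem height_eq_height_comap_add_one {R : Type*} [CommRing R] [IsNoetherianRing R]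
    {A : Subalgebra R R[X]} {s : R} (hs : s ∈ nonZeroDivisors R)
    (hsA : ∀ f : R[X], ∃ k : ℕ, (C s) ^ k * f ∈ A) (P : Ideal A) (hP : P.IsMaximal)
    (hsP : algebraMap R A s ∉ P) : P.height = (P.comap (algebraMap R A)).height + 1 := by
  let L := Localization.Away s
  have hinj : Function.Injective (algebraMap R L) :=
    IsLocalization.injective L (Submonoid.powers_le.2 hs)
  have : IsNoetherianRing L := IsLocalization.isNoetherianRing (Submonoid.powers s) L inferInstance
  let : Algebra A L[X] := ((mapRingHom (algebraMap R L)).comp A.val.toRingHom).toAlgebra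
  have hmap : ∀ a : A, algebraMap A L[X] a = (a : R[X]).map (algebraMap R L) := fun _ => rfl
  have hC : ∀ t : R, algebraMap A L[X] (algebraMap R A t) = C (algebraMap R L t) :=
    fun t => map_C _
  have hloc : IsLocalization (Submonoid.powers (algebraMap R A s)) L[X] := by
    rw [isLocalization_iff]
    refine ⟨?_, ?_, ?_⟩
    · rintro ⟨_, n, rfl⟩
      rw [map_pow, hC]
      exact ((IsLocalization.Away.algebraMap_isUnit s).map C).pow n
    · intro z
      obtain ⟨b, ⟨n, rfl⟩, hbz⟩ := IsLocalization.integerNormalization_spec (Submonoid.powers s) z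
      obtain ⟨k, hk⟩ := hsA (IsLocalization.integerNormalization (Submonoid.powers s) z)
      refine ⟨(⟨_, hk⟩, ⟨algebraMap R A s ^ (k + n), k + n, rfl⟩), ?_⟩
      change z * algebraMap A L[X] (algebraMap R A s ^ (k + n)) = _
      rw [hmap ⟨_, hk⟩, map_pow, hC]
      simp only [Polynomial.map_mul, hbz, Polynomial.map_pow, map_C, pow_add]
      rw [Algebra.smul_def, IsScalarTower.algebraMap_apply R L L[X], algebraMap_eq, map_pow, map_pow]
      ring
    · intro a b hab
      exact ⟨1, by rw [Subtype.ext (Polynomial.map_injective _ hinj hab)]⟩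
  have hdisj : Disjoint (Submonoid.powers (algebraMap R A s) : Set A) P := by
    rw [Set.disjoint_left]
    rintro _ ⟨n, rfl⟩ h
    exact hsP (hP.isPrime.mem_of_pow_mem n h)
  have hP' := hP.isPrime
  let Q : Ideal L[X] := P.map (algebraMap A L[X])
  have hQP : Q.comap (algebraMap A L[X]) = P :=
    IsLocalization.under_map_of_isPrime_disjoint (Submonoid.powers (algebraMap R A s)) L[X] hP' hdisj
  have hQunder : (Q.under A).IsMaximal := by rwa [Ideal.under_def, hQP]
  have hQ : Q.IsMaximal := .of_isLocalization_of_disjoint (Submonoid.powers (algebraMap R A s))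
  have h1 : Q.height = P.height :=
    IsLocalization.height_map_of_disjoint (Submonoid.powers (algebraMap R A s)) P hdisj
  have h2 := height_eq_height_add_one (Q.under L) Q
  rw [← h1, h2, ← IsLocalization.height_under (Submonoid.powers s) (Q.under L)]
  congr 2
  conv_rhs => rw [← hQP]
  ext t
  simp only [Ideal.under_def, Ideal.mem_comap, hC]
  rfl

theorem isMaximal_of_not_height_le {R : Type*} [CommRing R] [IsNoetherianRing R] {d : ℕ}
    (hdim : ringKrullDim R = d) {A : Subalgebra R R[X]} (hdimA : ringKrullDim A = (d + 1 : ℕ))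
    {s : R} (hs : s ∈ nonZeroDivisors R)
    (hsA : ∀ f : R[X], ∃ k : ℕ, (C s) ^ k * f ∈ A) (P : Ideal A) (hP : P.IsPrime)
    (hsP : algebraMap R A s ∉ P) (hd : ¬ P.height ≤ d) :
    P.IsMaximal ∧ (P.comap (algebraMap R A)).IsMaximal := by
  have hA : FiniteRingKrullDim A := by
    rw [finiteRingKrullDim_iff_ne_bot_and_top, hdimA]
    exact ⟨WithBot.coe_ne_bot, fun h => ENat.natCast_ne_top _ (WithBot.coe_injective h)⟩
  have hR : FiniteRingKrullDim R := by
    rw [finiteRingKrullDim_iff_ne_bot_and_top, hdim]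
    exact ⟨WithBot.coe_ne_bot, fun h => ENat.natCast_ne_top _ (WithBot.coe_injective h)⟩
  have h1 : P.height = (d + 1 : ℕ) := by
    refine le_antisymm ?_ ?_
    · have := Ideal.height_le_ringKrullDim_of_isPrime (I := P)
      rw [hdimA] at this
      exact WithBot.coe_le_coe.1 this
    · push_cast
      exact Order.add_one_le_of_lt (not_le.1 hd)
  have hmax : P.IsMaximal := Ideal.isMaximal_of_height_eq_ringKrullDim (by rw [h1, hdimA]; rfl)
  refine ⟨hmax, ?_⟩
  have h2 := height_eq_height_comap_add_one hs hsA P hmax hsP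
  rw [h1] at h2
  have h3 : (P.comap (algebraMap R A)).height = d := by
    push_cast at h2
    exact (ENat.add_left_injective_of_ne_top ENat.one_ne_top h2).symm
  exact Ideal.isMaximal_of_height_eq_ringKrullDim (by rw [h3, hdim]; rfl)

theorem exists_pow_mul_mem_of_coeff_mem {R : Type*} [CommRing R] {A : Subalgebra R R[X]} {s : R}
    (hsA : ∀ f : R[X], ∃ k : ℕ, (C s) ^ k * f ∈ A) (P : Ideal A) (q : R[X])
    (hq : ∀ i, algebraMap R A (q.coeff i) ∈ P) :
    ∃ (K : ℕ) (h : C (s ^ K) * q ∈ A), (⟨_, h⟩ : A) ∈ P := by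
  obtain ⟨K, hK⟩ := (eventually_forall_natDegree_le_mem hsA q.natDegree).exists
  refine ⟨K, hK q le_rfl, ?_⟩
  have h1 : ∀ i ∈ Finset.range (q.natDegree + 1), C (s ^ K) * X ^ i ∈ A := fun i hi =>
    hK _ ((natDegree_X_pow_le i).trans (Finset.mem_range_succ_iff.1 hi))
  have h2 : (⟨_, hK q le_rfl⟩ : A) = ∑ i ∈ (Finset.range (q.natDegree + 1)).attach,
      algebraMap R A (q.coeff i) * ⟨_, h1 i i.2⟩ := by
    apply Subtype.ext
    rw [AddSubmonoidClass.coe_finsetSum]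
    simp only [Subalgebra.coe_mul]
    rw [Finset.sum_attach (Finset.range (q.natDegree + 1))
      (fun i => ((algebraMap R A (q.coeff i) : A) : R[X]) * (C (s ^ K) * X ^ i))]
    conv_lhs => rw [q.as_sum_range_C_mul_X_pow, Finset.mul_sum]
    exact Finset.sum_congr rfl fun i _ => mul_left_comm _ _ _
  rw [h2]
  exact P.sum_mem fun i _ => P.mul_mem_right _ (hq i)

/-- A maximal ideal over a maximal ideal contains a polynomial whose leading coefficient is a power
of `s`. -/
theorem exists_leadingCoeff_eq_pow_of_isMaximal {R : Type*} [CommRing R]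
    {A : Subalgebra R R[X]} {s : R}
    (hsA : ∀ f : R[X], ∃ k : ℕ, (C s) ^ k * f ∈ A) (P : Ideal A) (hP : P.IsMaximal)
    (hp : (P.comap (algebraMap R A)).IsMaximal) :
    ∃ j ∈ P, ∃ k, (j : R[X]).leadingCoeff = s ^ k := by
  set p := P.comap (algebraMap R A)
  have hcoe : ∀ a : R, ((algebraMap R A a : A) : R[X]) = C a := fun _ => rfl
  obtain ⟨k, hk⟩ := hsA X
  by_cases hX : (⟨_, hk⟩ : A) ∈ P
  · refine ⟨_, hX, k, ?_⟩
    rw [leadingCoeff_mul_monic monic_X, ← C_pow, leadingCoeff_C]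
  obtain ⟨a, e, he, hae⟩ := hP.exists_inv hX
  have he0 : (e : R[X]).map (Ideal.Quotient.mk p) ≠ 0 := by
    intro h0
    have h1 : (e : R[X]).coeff 0 = 1 := by
      have := congrArg (fun a : A => (a : R[X]).coeff 0) hae
      simpa [mul_coeff_zero] using this
    have h2 := congrArg (fun q : (R ⧸ p)[X] => q.coeff 0) h0
    simp only [coeff_map, h1, map_one, coeff_zero] at h2
    have : Nontrivial (R ⧸ p) := Ideal.Quotient.nontrivial_iff.2 hp.ne_top
    exact one_ne_zero h2
  set D := ((e : R[X]).map (Ideal.Quotient.mk p)).natDegree with hD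
  have hc : (e : R[X]).coeff D ∉ p := by
    rw [← Ideal.Quotient.eq_zero_iff_mem, ← coeff_map]
    exact leadingCoeff_ne_zero.2 he0
  obtain ⟨u, v, hv, huv⟩ := hp.exists_inv hc
  let E : R[X] := ∑ i ∈ Finset.range D, C (u * (e : R[X]).coeff i) * X ^ i
  have hEdeg : E.degree < D := by
    refine (degree_sum_le _ _).trans_lt ((Finset.sup_lt_iff (WithBot.bot_lt_coe D)).2 fun i hi => ?_)
    exact (degree_C_mul_X_pow_le _ _).trans_lt (WithBot.coe_lt_coe.2 (Finset.mem_range.1 hi))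
  have hmonic : (X ^ D + E).Monic := monic_X_pow_add hEdeg
  have hEc : ∀ i, E.coeff i = if i < D then u * (e : R[X]).coeff i else 0 := by
    intro i
    simp only [E, finsetSum_coeff, coeff_C_mul, coeff_X_pow, mul_ite, mul_one, mul_zero]
    rw [Finset.sum_ite_eq]
    simp only [Finset.mem_range]
  obtain ⟨K, hKA, hK⟩ := exists_pow_mul_mem_of_coeff_mem hsA P (X ^ D + E - C u * (e : R[X])) (by
    intro i
    change _ ∈ p
    rw [coeff_sub, coeff_add, coeff_C_mul, coeff_X_pow, hEc]
    rcases lt_trichotomy i D with h | rfl | h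
    · rw [if_neg h.ne, if_pos h, zero_add, sub_self]
      exact p.zero_mem
    · rw [if_pos rfl, if_neg (lt_irrefl _), add_zero, ← huv, add_sub_cancel_left]
      exact hv
    · rw [if_neg h.ne', if_neg h.not_gt, zero_add, zero_sub]
      refine p.neg_mem (p.mul_mem_left _ ?_)
      rw [← Ideal.Quotient.eq_zero_iff_mem, ← coeff_map]
      exact coeff_eq_zero_of_natDegree_lt h)
  refine ⟨_, P.add_mem hK (P.mul_mem_left (algebraMap R A (s ^ K * u)) he), K, ?_⟩
  have : ((⟨_, hKA⟩ + algebraMap R A (s ^ K * u) * e : A) : R[X]) = C (s ^ K) * (X ^ D + E) := by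
    rw [Subalgebra.coe_add, Subalgebra.coe_mul, hcoe, C_mul]
    ring
  rw [this, leadingCoeff_mul_monic hmonic, leadingCoeff_C]

theorem orderIdeal_eq_top_iff {A M : Type*} [CommRing A] [AddCommGroup M] [Module A M]
    {f : A} {m : M} :
    orderIdeal A (f, m) = ⊤ ↔ ∃ (a : A) (φ : M →ₗ[A] A), a * f + φ m = 1 := by
  rw [Ideal.eq_top_iff_one]
  constructor
  · rintro ⟨L, hL⟩
    refine ⟨L (1, 0), L ∘ₗ LinearMap.inr A A M, Eq.trans ?_ hL⟩
    rw [mul_comm, ← smul_eq_mul, ← map_smul, LinearMap.comp_apply, ← map_add]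
    congr 1
    simp
  · rintro ⟨a, φ, h⟩
    exact ⟨a • LinearMap.fst A A M + φ ∘ₗ LinearMap.snd A A M, by simpa using h⟩

theorem SameOrbit.exists_mul_add_eq_one {A M : Type*} [CommRing A] [AddCommGroup M] [Module A M]
    {f f' : A} {m m' : M} (h : SameOrbit A (f, m) (f', m'))
    (hum : ∃ (a : A) (φ : M →ₗ[A] A), a * f + φ m = 1) :
    ∃ (a : A) (φ : M →ₗ[A] A), a * f' + φ m' = 1 := by
  rw [← orderIdeal_eq_top_iff, Ideal.eq_top_iff_one] at hum ⊢
  obtain ⟨α, hα⟩ := h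
  obtain ⟨L, hL⟩ := hum
  refine ⟨L ∘ₗ α.symm.toLinearMap, ?_⟩
  rw [← hα]
  simpa using hL

/-- The case `I = 0` of `exists_orderIdeal_not_le`. -/
theorem exists_orderIdeal_not_le_of_height_le {A M : Type*} [CommRing A] [IsNoetherianRing A]
    [AddCommGroup M] [Module A M] [Module.Finite A M] (u : A) (d : ℕ)
    {n : ℕ} (w : Fin n → M) (f : A) (m : M)
    (h : ∀ P : Ideal A, P.IsPrime → u ∉ P →
      HasDualFamilyAt (Submodule.span A (Set.range w)) P (d + 1))
    (hum : ∃ (a : A) (φ : M →ₗ[A] A), a * f + φ m = 1) :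
    ∃ x ∈ Submodule.span A (Set.range w), ∀ P : Ideal A, P.IsPrime → u ∉ P →
      orderIdeal A (m + f • x) ≤ P → ¬ P.height ≤ d := by
  obtain ⟨x, hx, hxq⟩ := exists_orderIdeal_not_le ⊥ u d w f m (fun P hP _ hu => h P hP hu) hum
  refine ⟨x, hx, fun P hP hu hle hht => ?_⟩
  let e : (A ⧸ (⊥ : Ideal A)) ≃+* A := RingEquiv.quotientBot A
  have he : ∀ a, e (Ideal.Quotient.mk ⊥ a) = a := fun _ => rfl
  obtain ⟨φ, hφ⟩ := hxq (P.comap e) (hP.comap _) (by rwa [Ideal.mem_comap, he])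
    (by rwa [RingEquiv.height_comap])
  rw [Ideal.mem_comap, he] at hφ
  exact hφ (hle ⟨φ, rfl⟩)

/-- An ideal all of whose prime overideals contain a polynomial whose leading coefficient is a power
of `s` contains such a polynomial. -/
theorem exists_leadingCoeff_eq_pow_of_forall_prime {R : Type*} [CommRing R] [Nontrivial R]
    {A : Subalgebra R R[X]} {s : R} (hs : s ∈ nonZeroDivisors R) (J : Ideal A)
    (h : ∀ P : Ideal A, P.IsPrime → J ≤ P → ∃ j ∈ P, ∃ k, (j : R[X]).leadingCoeff = s ^ k) :
    ∃ j ∈ J, ∃ k, (j : R[X]).leadingCoeff = s ^ k := by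
  let S : Submonoid A :=
    { carrier := {j | ∃ k, (j : R[X]).leadingCoeff = s ^ k}
      one_mem' := ⟨0, by simp⟩
      mul_mem' := by
        rintro a b ⟨k, hk⟩ ⟨l, hl⟩
        refine ⟨k + l, ?_⟩
        rw [Subalgebra.coe_mul, leadingCoeff_mul', hk, hl, pow_add]
        rw [hk, hl, ← pow_add]
        exact nonZeroDivisors.ne_zero (pow_mem hs _) }
  by_contra hJ
  push Not at hJ
  obtain ⟨P, hP, hJP, hdisj⟩ := Ideal.exists_le_prime_disjoint J S
    (Set.disjoint_left.2 fun j hj ⟨k, hk⟩ => hJ j hj k hk)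
  obtain ⟨j, hj, hk⟩ := h P hP hJP
  exact Set.disjoint_left.1 hdisj hj hk

theorem exists_leadingCoeff_add_eq_pow {R : Type*} [CommRing R] [Nontrivial R] {s : R}
    (hs : s ∈ nonZeroDivisors R) (f j : R[X]) {k : ℕ} (hj : j.leadingCoeff = s ^ k) (a b : ℕ) :
    ∃ (L k' : ℕ), (f + C (s ^ b) * X * ((C (s ^ a) * X) ^ L * j)).leadingCoeff = s ^ k' := by
  refine ⟨f.natDegree, b + (a * f.natDegree + k), ?_⟩
  have hX : C (s ^ b) * X * ((C (s ^ a) * X) ^ f.natDegree * j) =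
      C (s ^ (b + a * f.natDegree)) * j * X ^ (f.natDegree + 1) := by
    rw [mul_pow, pow_add s, C_mul, pow_mul, C_pow (n := f.natDegree)]
    ring
  have hlc : (C (s ^ (b + a * f.natDegree)) * j).leadingCoeff = s ^ (b + (a * f.natDegree + k)) := by
    rw [leadingCoeff_mul', leadingCoeff_C, hj, ← pow_add, add_assoc]
    rw [leadingCoeff_C, hj, ← pow_add]
    exact nonZeroDivisors.ne_zero (pow_mem hs _)
  have hne : C (s ^ (b + a * f.natDegree)) * j ≠ 0 := by
    rw [← leadingCoeff_ne_zero, hlc]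
    exact nonZeroDivisors.ne_zero (pow_mem hs _)
  rw [hX, leadingCoeff_add_of_degree_lt, leadingCoeff_mul_X_pow, hlc]
  refine degree_lt_degree ?_
  rw [natDegree_mul_X_pow _ hne]
  omega

/-- The ideal of all `t` with `t G ∈ J` is comaximal with `s`. -/
theorem exists_dvd_sub_one_mul_mem {R : Type*} [CommRing R] {A : Type*} [CommRing A] [Algebra R A]
    {s : R} {G c : A} (hsG : algebraMap R A s ∣ G) (J : Ideal A) (hJ : G * (1 + G * c) ∈ J)
    (h : ∀ P : Ideal A, P.IsPrime → J ≤ P → G ∉ P → (P.comap (algebraMap R A)).IsMaximal) :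
    ∃ b : R, s ∣ b - 1 ∧ algebraMap R A b * G ∈ J := by
  let q : Ideal R := (J.colon {G}).comap (algebraMap R A)
  have hq : ∀ t, t ∈ q ↔ algebraMap R A t * G ∈ J := fun t => by
    rw [Ideal.mem_comap, Submodule.mem_colon_singleton, smul_eq_mul]
  suffices hqs : q ⊔ Ideal.span {s} = ⊤ by
    have h1 : (1 : R) ∈ q ⊔ Ideal.span {s} := hqs ▸ Submodule.mem_top
    obtain ⟨b, hb, y, hy, hby⟩ := Submodule.mem_sup.1 h1
    refine ⟨b, ?_, (hq b).1 hb⟩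
    rw [← hby, sub_add_cancel_left, dvd_neg]
    exact Ideal.mem_span_singleton.1 hy
  by_contra hne
  obtain ⟨n, hn, hle⟩ := Ideal.exists_le_maximal _ hne
  have hn' := hn.isPrime
  let S : Submonoid A := n.primeCompl.map (algebraMap R A) ⊔ Submonoid.powers G
  have hmem : ∃ t ∉ n, ∃ k, algebraMap R A t * G ^ k ∈ J := by
    by_contra hcon
    push Not at hcon
    obtain ⟨P, hP, hJP, hdisj⟩ := Ideal.exists_le_prime_disjoint J S (by
      rw [Set.disjoint_left]
      rintro a ha haS
      obtain ⟨_, ⟨t, ht, rfl⟩, _, ⟨k, rfl⟩, rfl⟩ := Submonoid.mem_sup.1 haS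
      exact hcon t ht k ha)
    have hGP : G ∉ P := fun hG =>
      Set.disjoint_left.1 hdisj hG (Submonoid.mem_sup_right (Submonoid.mem_powers G))
    have hsub : P.comap (algebraMap R A) ≤ n := fun t ht => by
      by_contra htn
      exact Set.disjoint_left.1 hdisj ht (Submonoid.mem_sup_left ⟨t, htn, rfl⟩)
    have hs : s ∈ P.comap (algebraMap R A) := by
      rw [(h P hP hJP hGP).eq_of_le hn.ne_top hsub]
      exact hle (Ideal.mem_sup_right (Ideal.mem_span_singleton_self s))
    exact hGP (P.mem_of_dvd hsG hs)
  obtain ⟨t, ht, k, hk⟩ := hmem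
  refine ht (hle (Ideal.mem_sup_left ((hq t).2 ?_)))
  obtain ⟨u, v, huv⟩ : IsCoprime (1 + G * c) (G ^ k) := IsCoprime.pow_right ⟨1, -c, by ring⟩
  have : algebraMap R A t * G =
      (algebraMap R A t * u) * (G * (1 + G * c)) + (G * v) * (algebraMap R A t * G ^ k) := by
    linear_combination (-(algebraMap R A t * G)) * huv
  rw [this]
  exact J.add_mem (J.mul_mem_left _ hJ) (J.mul_mem_left _ hk)

theorem mem_nonZeroDivisors_of_coe {R : Type*} [CommRing R] {A : Subalgebra R R[X]} {a : A}
    (ha : (a : R[X]) ∈ nonZeroDivisors R[X]) : a ∈ nonZeroDivisors A :=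
  mem_nonZeroDivisors_of_injective (f := A.val) Subtype.val_injective ha

theorem C_mem_nonZeroDivisors {R : Type*} [CommRing R] {s : R} (hs : s ∈ nonZeroDivisors R) :
    C s ∈ nonZeroDivisors R[X] := by
  rw [mem_nonZeroDivisors_iff_right]
  intro p hp
  ext i
  have := congrArg (fun p : R[X] => p.coeff i) hp
  simp only [coeff_mul_C, coeff_zero] at this
  exact (mul_right_mem_nonZeroDivisors_eq_zero_iff hs).1 this

theorem exists_eq_smul_of_mem_span_smul {A M ι : Type*} [CommRing A] [AddCommGroup M] [Module A M]
    (c : A) (z : ι → M) {y : M} (hy : y ∈ Submodule.span A (Set.range fun j => c • z j)) :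
    ∃ y', y = c • y' := by
  have : Submodule.span A (Set.range fun j => c • z j) ≤
      LinearMap.range (LinearMap.lsmul A M c) := by
    rw [Submodule.span_le]
    rintro _ ⟨j, rfl⟩
    exact ⟨z j, rfl⟩
  obtain ⟨y', hy'⟩ := this hy
  exact ⟨y', hy'.symm⟩

theorem sameOrbit_one_zero_of_sq {R : Type*} [CommRing R] [IsNoetherianRing R] [Nontrivial R]
    {A : Subalgebra R R[X]} [IsNoetherianRing A] {d : ℕ} (hdim : ringKrullDim R = d)
    (hdimA : ringKrullDim A = (d + 1 : ℕ)) {s : R} (hs : s ∈ nonZeroDivisors R)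
    (hsA : ∀ f : R[X], ∃ k : ℕ, (C s) ^ k * f ∈ A)
    {M : Type*} [AddCommGroup M] [Module A M] [Module.Finite A M]
    {x : ℕ → M} {φ : ℕ → M →ₗ[A] A} {r : ℕ → R} {N : ℕ}
    (hφ : ∀ i j, φ i (x j) = if i = j then algebraMap R A (r i) else 0)
    (hφx : ∀ u, ∑ j ∈ Finset.range (N + 1), φ j u • x j = algebraMap R A s • u)
    (hr : ∀ j < d + 1, r j = s) {a : ℕ} {H G : A} (hH : (H : R[X]) = C (s ^ a) * X)
    (hG : G = algebraMap R A s * H) (c : A) (m : M)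
    (hum : ∃ (a : A) (θ : M →ₗ[A] A), a * (1 + G * c) + θ (G ^ 2 • m) = 1) :
    SameOrbit A (1 + G * c, G ^ 2 • m) ((1 : A), (0 : M)) := by
  have hcoe : ∀ t : R, ((algebraMap R A t : A) : R[X]) = C t := fun _ => rfl
  set f := 1 + G * c with hf
  have h1 : SameOrbit A (f, G ^ 2 • m) (f, G ^ 2 • m + f • H • x 0) := sameOrbit_snd_add_smul _ _ _
  obtain ⟨y, hy, hP⟩ := exists_orderIdeal_not_le_of_height_le G d
    (fun j : Fin (d + 1) => G ^ 2 • x j) f (G ^ 2 • m + f • H • x 0) (by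
      intro P hP hGP
      refine ⟨algebraMap R A s * G ^ 2, fun h => ?_, fun j => φ j, fun j => G ^ 2 • x j,
        fun j => Submodule.subset_span ⟨j, rfl⟩, fun i j => ?_⟩
      · rcases hP.mem_or_mem h with h | h
        · exact hGP (hG ▸ P.mul_mem_right _ h)
        · exact hGP (hP.mem_of_pow_mem _ h)
      · rw [map_smul, hφ, hr i i.2, smul_eq_mul]
        simp only [Fin.val_inj]
        split_ifs <;> ring) (h1.exists_mul_add_eq_one hum)
  obtain ⟨y, rfl⟩ := exists_eq_smul_of_mem_span_smul _ _ hy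
  set m₂ := G ^ 2 • m + f • H • x 0 + f • G ^ 2 • y with hm₂
  have h2 := h1.trans (sameOrbit_snd_add_smul f _ (G ^ 2 • y))
  rw [← hm₂] at h2
  set J := orderIdeal A m₂ with hJ
  have hmax : ∀ P : Ideal A, P.IsPrime → J ≤ P → G ∉ P →
      P.IsMaximal ∧ (P.comap (algebraMap R A)).IsMaximal := fun P hPp hJP hGP =>
    isMaximal_of_not_height_le hdim hdimA hs hsA P hPp
      (fun h => hGP (hG ▸ P.mul_mem_right _ h)) (hP P hPp hGP hJP)
  obtain ⟨b, hb, hbJ⟩ := exists_dvd_sub_one_mul_mem (R := R) (s := s) (G := G)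
    (c := φ 0 m + c + f * φ 0 y) ⟨H, hG⟩ J ⟨φ 0, by
      change φ 0 m₂ = _
      rw [hm₂]
      simp only [map_add, map_smul, smul_eq_mul, hφ, if_true, hr 0 d.succ_pos]
      rw [hf]
      linear_combination (-1 - G * c) * hG⟩ fun P hPp hJP hGP => (hmax P hPp hJP hGP).2
  obtain ⟨j, ⟨θ, hθ⟩, k, hk⟩ := exists_leadingCoeff_eq_pow_of_forall_prime hs J (by
    intro P hPp hJP
    by_cases hGP : G ∈ P
    · rw [hG] at hGP
      rcases hPp.mem_or_mem hGP with h | h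
      · exact ⟨_, h, 1, by rw [hcoe, leadingCoeff_C, pow_one]⟩
      · exact ⟨_, h, a, by rw [hH, leadingCoeff_mul_monic monic_X, leadingCoeff_C]⟩
    · obtain ⟨h, h'⟩ := hmax P hPp hJP hGP
      exact exists_leadingCoeff_eq_pow_of_isMaximal hsA P h h')
  have hGcoe : (G : R[X]) = C (s ^ (a + 1)) * X := by
    rw [hG, Subalgebra.coe_mul, hcoe, hH, pow_succ', C_mul, mul_assoc]
  obtain ⟨L, k', hk'⟩ := exists_leadingCoeff_add_eq_pow hs (f : R[X]) (j : R[X]) hk a (a + 1)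
  have h3 := h2.trans (sameOrbit_fst_add f m₂ ((G * H ^ L) • θ))
  have hf' : f + ((G * H ^ L) • θ) m₂ = 1 + H * (algebraMap R A s * (c + H ^ L * j)) := by
    rw [LinearMap.smul_apply, show θ m₂ = j from hθ, smul_eq_mul, hf, hG]
    ring
  rw [hf'] at h3
  refine h3.trans ?_
  obtain ⟨φ₀, hφ₀⟩ := hbJ
  have hHnzd : H ∈ nonZeroDivisors A :=
    mem_nonZeroDivisors_of_coe (hH ▸ mul_mem (C_mem_nonZeroDivisors (pow_mem hs a))
      monic_X.mem_nonZeroDivisors)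
  refine sameOrbit_one_zero_of_leadingCoeff hsA hφ (hr 0 d.succ_pos) hH hHnzd rfl
    (N := N) (k := k') ?_ (ν := fun j => φ j (G • (m + f • y)) + if j = 0 then f else 0) ?_ ?_
    (h3.exists_mul_add_eq_one hum) hb ((c + H ^ L * j) • φ₀) ?_
  · rw [← hk', ← hf', LinearMap.smul_apply, show θ m₂ = j from hθ, smul_eq_mul, Subalgebra.coe_add,
      Subalgebra.coe_mul, Subalgebra.coe_mul, Subalgebra.coe_pow, hGcoe, hH, mul_assoc]
  · intro i
    have h4 : ∀ u, algebraMap R A (r i) * φ i u = algebraMap R A s * φ i u := fun u => by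
      have h5 := congrArg (φ i) (hφx u)
      simp only [map_sum, map_smul, smul_eq_mul, hφ, mul_ite, mul_zero] at h5
      rw [Finset.sum_ite_eq] at h5
      split_ifs at h5 with hi
      · rw [mul_comm, h5]
      · have h6 : φ i u = 0 :=
          (mul_left_mem_nonZeroDivisors_eq_zero_iff (mem_nonZeroDivisors_of_coe
            (a := algebraMap R A s) (C_mem_nonZeroDivisors hs))).1 h5.symm
        rw [h6, mul_zero, mul_zero]
    by_cases hi : i = 0
    · rw [hi, hr 0 d.succ_pos]
    · simpa only [if_neg hi, add_zero] using h4 _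
  · have h4 := congrArg (fun v => H • v) (hφx (G • (m + f • y)))
    simp only [Finset.smul_sum, smul_smul] at h4
    simp only [mul_add, mul_ite, mul_zero, add_smul, Finset.sum_add_distrib, ite_smul, zero_smul]
    rw [Finset.sum_ite_eq']
    simp only [Finset.mem_range, Nat.succ_pos, if_true]
    rw [h4, hm₂, hG]
    module
  · rw [LinearMap.smul_apply, show φ₀ m₂ = _ from hφ₀, smul_eq_mul, hG]
    ring

theorem exists_smul_orderIdeal_not_le {A M : Type*} [CommRing A] [IsNoetherianRing A]
    [AddCommGroup M] [Module A M] [Module.Finite A M] {d : ℕ} (hdimA : ringKrullDim A = (d + 1 : ℕ))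
    {σ : A} (hσ : σ ∈ nonZeroDivisors A) (u : A) (f : A) (m : M)
    (h : ∀ P : Ideal A, P.IsPrime → u ∉ P → HasDualFamilyAt (⊤ : Submodule A M) P (d + 1))
    (hum : ∃ (a : A) (φ : M →ₗ[A] A), a * f + φ m = 1) :
    ∃ y : M, ∀ P : Ideal A, P.IsPrime → orderIdeal A (m + f • u ^ 2 • y) ≤ P → σ ∈ P → u ∈ P := by
  obtain ⟨n, z, hz⟩ := Module.Finite.exists_fin (R := A) (M := M)
  obtain ⟨x, hx, hxq⟩ := exists_orderIdeal_not_le (Ideal.span {σ}) u d (fun j => u ^ 2 • z j) f m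
    (fun P hP _ hu => by
      obtain ⟨c, hc, φ, y, -, hφ⟩ := h P hP hu
      refine ⟨c * u ^ 2, fun hmem => ?_, φ, fun j => u ^ 2 • y j, fun j => ?_, fun i j => ?_⟩
      · rcases hP.mem_or_mem hmem with h | h
        · exact hc h
        · exact hu (hP.mem_of_pow_mem _ h)
      · have hle : Submodule.span A (Set.range z) ≤
            (Submodule.span A (Set.range fun j => u ^ 2 • z j)).comap
              (LinearMap.lsmul A M (u ^ 2)) := by
          rw [Submodule.span_le]
          rintro _ ⟨i, rfl⟩
          exact Submodule.subset_span ⟨i, rfl⟩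
        exact hle (hz ▸ Submodule.mem_top : y j ∈ _)
      · rw [map_smul, hφ, smul_eq_mul]
        split_ifs <;> ring) hum
  obtain ⟨y, rfl⟩ := exists_eq_smul_of_mem_span_smul _ _ hx
  refine ⟨y, fun P hP hle hσP => by_contra fun hu => ?_⟩
  have hker : RingHom.ker (Ideal.Quotient.mk (Ideal.span {σ})) ≤ P := by
    rw [Ideal.mk_ker, Ideal.span_singleton_le_iff_mem]
    exact hσP
  have hq : (P.map (Ideal.Quotient.mk (Ideal.span {σ}))).IsPrime :=
    Ideal.map_isPrime_of_surjective Ideal.Quotient.mk_surjective hker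
  have hmem : ∀ a, Ideal.Quotient.mk (Ideal.span {σ}) a ∈
      P.map (Ideal.Quotient.mk (Ideal.span {σ})) ↔ a ∈ P := fun a => by
    rw [← Ideal.mem_comap, Ideal.comap_map_of_surjective' _ Ideal.Quotient.mk_surjective,
      sup_eq_left.2 hker]
  obtain ⟨φ, hφ⟩ := hxq _ hq (by rwa [hmem]) (by
    have h1 := Ideal.height_le_ringKrullDim_of_isPrime
      (I := P.map (Ideal.Quotient.mk (Ideal.span {σ})))
    have h2 := ringKrullDim_quotient_succ_le_of_nonZeroDivisor hσ
    have h3 := (add_le_add_left h1 1).trans h2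
    rw [hdimA] at h3
    have h4 : (P.map (Ideal.Quotient.mk (Ideal.span {σ}))).height + 1 ≤ (d : ℕ∞) + 1 :=
      WithBot.coe_le_coe.1 h3
    exact (ENat.add_le_add_iff_right ENat.one_ne_top).1 h4)
  rw [hmem] at hφ
  exact hφ (hle ⟨φ, rfl⟩)

theorem mem_sup_span_pow_of_forall_prime {A : Type*} [CommRing A] {J : Ideal A} {g c σ : A}
    (hJ : g * (1 + g * c) ∈ J) (h : ∀ P : Ideal A, P.IsPrime → J ≤ P → σ ∈ P → g ∈ P) (N : ℕ) :
    g ∈ J ⊔ Ideal.span {σ ^ N} := by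
  have hrad : g ∈ (J ⊔ Ideal.span {σ ^ N}).radical := by
    rw [Ideal.radical_eq_sInf, Ideal.mem_sInf]
    rintro P ⟨hle, hP⟩
    exact h P hP (le_sup_left.trans hle)
      (hP.mem_of_pow_mem N (hle (Ideal.mem_sup_right (Ideal.mem_span_singleton_self _))))
  obtain ⟨k, hk⟩ := hrad
  obtain ⟨u, v, huv⟩ : IsCoprime (1 + g * c) (g ^ k) := IsCoprime.pow_right ⟨1, -c, by ring⟩
  have : g = u * (g * (1 + g * c)) + (g * v) * g ^ k := by linear_combination (-g) * huv
  rw [this]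
  exact Ideal.add_mem _ (Ideal.mul_mem_left _ _ (Ideal.mem_sup_left hJ)) (Ideal.mul_mem_left _ _ hk)

theorem mem_idealIA {R : Type*} [CommRing R] {A : Subalgebra R R[X]} {p : A} :
    p ∈ idealIA A ↔ (p : R[X]).coeff 0 = 0 := by
  rw [coeff_zero_eq_eval_zero]
  rfl

open Filter in
theorem exists_pow_mul_eq_mul_of_mem_idealIA {R : Type*} [CommRing R] {A : Subalgebra R R[X]}
    [IsNoetherianRing A] {s : R} (hsA : ∀ f : R[X], ∃ k : ℕ, (C s) ^ k * f ∈ A) {H : A} {a : ℕ}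
    (hH : (H : R[X]) = C (s ^ a) * X) :
    ∃ k, ∀ p ∈ idealIA A, ∃ q : A, algebraMap R A s ^ k * p = H * q := by
  have hcoe : ((algebraMap R A s : A) : R[X]) = C s := rfl
  have h1 : ∀ p ∈ idealIA A, ∀ᶠ k in atTop, H ∣ algebraMap R A s ^ k * p := fun p hp => by
    obtain ⟨k, hk⟩ := hsA (p : R[X]).divX
    filter_upwards [eventually_ge_atTop (a + k)] with K hK
    obtain ⟨l, rfl⟩ := Nat.exists_eq_add_of_le hK
    refine ⟨algebraMap R A s ^ l * ⟨_, hk⟩, Subtype.ext ?_⟩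
    have h2 : (p : R[X]) = (p : R[X]).divX * X := by
      conv_lhs => rw [← divX_mul_X_add (p : R[X]), mem_idealIA.1 hp, C_0, add_zero]
    rw [Subalgebra.coe_mul, Subalgebra.coe_mul, Subalgebra.coe_mul, Subalgebra.coe_pow,
      Subalgebra.coe_pow, hcoe, hH, C_pow]
    conv_lhs => rw [h2]
    ring
  obtain ⟨t, ht⟩ := IsNoetherian.noetherian (idealIA A)
  have h3 : ∀ᶠ k in atTop, ∀ p ∈ t, H ∣ algebraMap R A s ^ k * p :=
    (eventually_all_finset t).2 fun p hp => h1 p (ht ▸ Submodule.subset_span hp)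
  obtain ⟨k, hk⟩ := h3.exists
  refine ⟨k, fun p hp => ?_⟩
  change H ∣ _
  rw [← ht] at hp
  induction hp using Submodule.span_induction with
  | mem p hp => exact hk p hp
  | zero => simp
  | add p q _ _ hp hq => rw [mul_add]; exact dvd_add hp hq
  | smul c p _ hp => rw [smul_eq_mul, mul_left_comm]; exact hp.mul_left c

/-- Cancellation under the assumption `hβ`, which is superfluous when `M` is projective, see
`sameOrbit_one_zero_of_projective`. -/
theorem sameOrbit_one_zero_of_mem_orderIdeal {R : Type*} [CommRing R] [IsNoetherianRing R]
    [IsReduced R] [Nontrivial R] {A : Subalgebra R R[X]} [IsNoetherianRing A] {d : ℕ}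
    (hdim : ringKrullDim R = d) (hdimA : ringKrullDim A = (d + 1 : ℕ)) {s : R}
    (hs : s ∈ nonZeroDivisors R) (hsA : ∀ f : R[X], ∃ k : ℕ, (C s) ^ k * f ∈ A)
    {M : Type*} [AddCommGroup M] [Module A M] [Module.Finite A M]
    (htf : ∀ m : M, ∀ a ∈ nonZeroDivisors A, a • m = 0 → m = 0) {g : A} (hgI : g ∈ idealIA A)
    (hg : g ∈ nonZeroDivisors A)
    (h : ∀ P : Ideal A, P.IsPrime → g ∉ P → HasDualFamilyAt (⊤ : Submodule A M) P (d + 1))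
    {h₀ : A} {n : M}
    (hum : ∃ (a : A) (φ : M →ₗ[A] A), a * (1 + g * h₀) + φ (g • n) = 1) {g' : A}
    (hβ : g + g ^ 2 * g' ∈ orderIdeal A (g • n)) :
    SameOrbit A (1 + g * h₀, g • n) ((1 : A), (0 : M)) := by
  obtain ⟨s, hs, hsA, ν, r, φ, x, hφ, hφx, hr⟩ := exists_dualFamily_of_torsionFree A hs hsA htf hg h
  have hcoe : ∀ t : R, ((algebraMap R A t : A) : R[X]) = C t := fun _ => rfl
  have hσ : algebraMap R A s ∈ nonZeroDivisors A :=
    mem_nonZeroDivisors_of_coe (C_mem_nonZeroDivisors hs)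
  obtain ⟨N, rfl⟩ : ∃ N, ν = N + 1 := by
    refine Nat.exists_eq_succ_of_ne_zero ?_
    rintro rfl
    have h1 := congrArg (φ 0) (hφx (x 0))
    rw [Finset.range_zero, Finset.sum_empty, map_zero, map_smul, hφ, if_pos rfl,
      hr 0 d.succ_pos, smul_eq_mul] at h1
    have : Nontrivial A := inferInstance
    exact nonZeroDivisors.ne_zero (mul_mem hσ hσ) h1.symm
  obtain ⟨a, ha⟩ := hsA X
  rw [← C_pow] at ha
  set H : A := ⟨_, ha⟩ with hHdef
  have hH : (H : R[X]) = C (s ^ a) * X := rfl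
  obtain ⟨k, hk⟩ := exists_pow_mul_eq_mul_of_mem_idealIA hsA hH
  set σ := algebraMap R A s with hσdef
  set f := 1 + g * h₀ with hf
  obtain ⟨y, hy⟩ := exists_smul_orderIdeal_not_le hdimA hσ g f (g • n) h hum
  set n' := n + f • g • y with hn'
  have hm' : g • n + f • g ^ 2 • y = g • n' := by rw [hn']; module
  have h1 := sameOrbit_snd_add_smul f (g • n) (g ^ 2 • y)
  rw [hm'] at h1 hy
  obtain ⟨β, hβ⟩ := hβ
  have hJ : g * (1 + g * (g' + f * β y)) ∈ orderIdeal A (g • n') := by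
    refine ⟨β, ?_⟩
    change β _ = _
    rw [← hm', map_add, show β (g • n) = _ from hβ, map_smul, map_smul, smul_eq_mul, smul_eq_mul]
    ring
  obtain ⟨_, ⟨θ, rfl⟩, _, hc, hθc⟩ := Submodule.mem_sup.1
    (mem_sup_span_pow_of_forall_prime hJ hy (2 * (k + 1)))
  obtain ⟨c, rfl⟩ := Ideal.mem_span_singleton.1 hc
  change θ (g • n') + _ = g at hθc
  have hcI : c ∈ idealIA A := by
    rw [map_smul, smul_eq_mul] at hθc
    have h2 := congrArg (fun p : A => (p : R[X]).coeff 0) hθc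
    simp only [Subalgebra.coe_add, Subalgebra.coe_mul, Subalgebra.coe_pow, coeff_add,
      mul_coeff_zero, mem_idealIA.1 hgI, zero_mul, zero_add, hσdef, hcoe, ← C_pow, coeff_C_zero] at h2
    exact mem_idealIA.2 ((mul_left_mem_nonZeroDivisors_eq_zero_iff (pow_mem hs _)).1 h2)
  obtain ⟨q, hq⟩ := hk c hcI
  obtain ⟨q', hq'⟩ := hk g hgI
  have h2 := h1.trans (sameOrbit_fst_add f (g • n') (-h₀ • θ))
  have h3 : f + (-h₀ • θ) (g • n') = 1 + σ * H * (σ ^ (k + 1) * q * h₀) := by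
    rw [LinearMap.smul_apply, smul_eq_mul, hf]
    linear_combination (-h₀) * hθc + h₀ * σ ^ (k + 2) * hq
  rw [h3] at h2
  have h4 := h2.trans (sameOrbit_snd_add_smul _ _ (-(g • n')))
  have h5 : g • n' + (1 + σ * H * (σ ^ (k + 1) * q * h₀)) • -(g • n') =
      (σ * H) ^ 2 • (-(q * h₀ * q')) • n' := by
    have : -((σ * H * (σ ^ (k + 1) * q * h₀)) * g) = (σ * H) ^ 2 * (-(q * h₀ * q')) := by
      linear_combination (-(σ ^ 2 * H * q * h₀)) * hq'
    rw [smul_smul, ← this]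
    module
  rw [h5] at h4
  exact h4.trans (sameOrbit_one_zero_of_sq hdim hdimA hs hsA hφ hφx hr hH rfl _ _
    (h4.exists_mul_add_eq_one hum))

theorem sameOrbit_one_zero_of_projective {R : Type*} [CommRing R] [IsNoetherianRing R]
    [IsReduced R] [Nontrivial R] {A : Subalgebra R R[X]} [IsNoetherianRing A] {d : ℕ}
    (hdim : ringKrullDim R = d) (hdimA : ringKrullDim A = (d + 1 : ℕ)) {s : R}
    (hs : s ∈ nonZeroDivisors R) (hsA : ∀ f : R[X], ∃ k : ℕ, (C s) ^ k * f ∈ A)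
    {M : Type*} [AddCommGroup M] [Module A M] [Module.Finite A M] [Module.Projective A M]
    (htf : ∀ m : M, ∀ a ∈ nonZeroDivisors A, a • m = 0 → m = 0) {g : A} (hgI : g ∈ idealIA A)
    (hg : g ∈ nonZeroDivisors A)
    (h : ∀ P : Ideal A, P.IsPrime → g ∉ P → HasDualFamilyAt (⊤ : Submodule A M) P (d + 1))
    {h₀ : A} {n : M}
    (hum : ∃ (a : A) (φ : M →ₗ[A] A), a * (1 + g * h₀) + φ (g • n) = 1) :
    SameOrbit A (1 + g * h₀, g • n) ((1 : A), (0 : M)) := by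
  obtain ⟨a, φ, haφ⟩ := id hum
  obtain ⟨y, hy⟩ := exists_smul_orderIdeal_not_le hdimA hg 1 (1 + g * h₀) n
    (fun P hP _ => hasDualFamilyAt_of_projective hg h P hP) ⟨a, g • φ, by simpa using haφ⟩
  rw [one_pow, one_smul] at hy
  set n' := n + (1 + g * h₀) • y with hn'
  have h1 := sameOrbit_snd_add_smul (1 + g * h₀) (g • n) (g • y)
  rw [show g • n + (1 + g * h₀) • g • y = g • n' by rw [hn']; module] at h1
  have htop : orderIdeal A n' ⊔ Ideal.span {g} = ⊤ := by
    by_contra hne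
    obtain ⟨P, hP, hle⟩ := Ideal.exists_le_maximal _ hne
    exact hP.ne_top (P.eq_top_iff_one.2 (hy P hP.isPrime (le_sup_left.trans hle)
      (hle (Ideal.mem_sup_right (Ideal.mem_span_singleton_self g)))))
  obtain ⟨_, ⟨θ, rfl⟩, _, hc, hθc⟩ := Submodule.mem_sup.1 (htop ▸ Submodule.mem_top : (1 : A) ∈ _)
  obtain ⟨c, rfl⟩ := Ideal.mem_span_singleton.1 hc
  refine h1.trans (sameOrbit_one_zero_of_mem_orderIdeal hdim hdimA hs hsA htf hgI hg h
    (h1.exists_mul_add_eq_one hum) (g' := -c) ⟨θ, ?_⟩)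
  change θ (g • n') = _
  change θ n' + _ = 1 at hθc
  rw [map_smul, smul_eq_mul]
  linear_combination g * hθc

theorem SameOrbit.nonempty_quotient_equiv {A M : Type*} [CommRing A] [AddCommGroup M] [Module A M]
    {f : A} {m : M} (h : SameOrbit A (f, m) ((1 : A), (0 : M))) :
    Nonempty (((A × M) ⧸ Submodule.span A {((f, m) : A × M)}) ≃ₗ[A] M) := by
  obtain ⟨α, hα⟩ := h
  let L : A × M →ₗ[A] M := LinearMap.snd A A M ∘ₗ α.toLinearMap
  have hL : Function.Surjective L := fun y => ⟨α.symm (0, y), by simp [L]⟩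
  have hker : Submodule.span A {((f, m) : A × M)} = LinearMap.ker L := by
    ext v
    rw [Submodule.mem_span_singleton, LinearMap.mem_ker]
    constructor
    · rintro ⟨a, rfl⟩
      change (α _).2 = 0
      rw [map_smul, hα, Prod.smul_snd, smul_zero]
    · intro hv
      refine ⟨(α v).1, α.injective ?_⟩
      rw [map_smul, hα]
      exact Prod.ext (by simp) ((smul_zero _).trans (Eq.symm hv))
  exact ⟨(Submodule.quotEquivOfEq _ _ hker).trans (L.quotKerEquivOfSurjective hL)⟩

theorem stmt_5 {R : Type*} [CommRing R] [IsNoetherianRing R] (d : ℕ) (hd : 1 ≤ d)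
    (hdim : ringKrullDim R = (d : ℕ))
    (A : Subalgebra R (Polynomial R)) (hA : IsGeometricSubring A d) (hred : IsReduced A)
    (M : Type*) [AddCommGroup M] [Module A M] [Module.Finite A M]
    (htf : ∀ m : M, ∀ a ∈ nonZeroDivisors A, a • m = 0 → m = 0)
    (g : A) (hgI : g ∈ idealIA A) (hgnzd : g ∈ nonZeroDivisors A)
    (hproj : Module.Projective (Localization (Submonoid.powers g))
      (LocalizedModule (Submonoid.powers g) M))
    (hrank : ∀ (q : Ideal (Localization (Submonoid.powers g))) (hq : q.IsPrime),
      d + 1 ≤ rankAt (R := Localization (Submonoid.powers g)) (LocalizedModule (Submonoid.powers g) M) q hq)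
    (f : A) (m : M) (hum : orderIdeal A ((f, m) : A × M) = ⊤)
    (h1a : f - 1 ∈ Ideal.span {g})
    (h1b : m ∈ (Ideal.span {g} : Ideal A) • (⊤ : Submodule A M)) :
    ((∃ g' : A, g + g ^ 2 * g' ∈ orderIdeal A m) →
      (Nonempty (((A × M) ⧸ Submodule.span A {((f, m) : A × M)}) ≃ₗ[A] M) ∧
        ∃ α : (A × M) ≃ₗ[A] (A × M), α (f, m) = (1, 0))) ∧
    (Module.Projective A M →
      (Nonempty (((A × M) ⧸ Submodule.span A {((f, m) : A × M)}) ≃ₗ[A] M) ∧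
        ∃ α : (A × M) ≃ₗ[A] (A × M), α (f, m) = (1, 0))) := by
  obtain ⟨hAN, ⟨s, hs, hsA⟩, hdimA⟩ := hA
  have : Nontrivial R := by
    by_contra hR
    rw [not_nontrivial_iff_subsingleton] at hR
    exact WithBot.coe_ne_bot (hdim.symm.trans ringKrullDim_eq_bot_of_subsingleton)
  have hRred : IsReduced R := isReduced_of_injective (algebraMap R A) fun a b hab =>
    C_injective (congrArg Subtype.val hab)
  have hfam : ∀ P : Ideal A, P.IsPrime → g ∉ P → HasDualFamilyAt (⊤ : Submodule A M) P (d + 1) :=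
    hasDualFamilyAt_of_notMem g hproj hrank
  obtain ⟨h₀, hh₀⟩ := Ideal.mem_span_singleton.1 h1a
  obtain rfl : f = 1 + g * h₀ := by rw [← hh₀]; ring
  obtain ⟨n, -, rfl⟩ := (Submodule.mem_smul_pointwise_iff_exists _ _ _).1
    ((Submodule.ideal_span_singleton_smul g (⊤ : Submodule A M)) ▸ h1b)
  rw [orderIdeal_eq_top_iff] at hum
  refine ⟨fun ⟨g', hg'⟩ => ?_, fun hP => ?_⟩
  · have h := sameOrbit_one_zero_of_mem_orderIdeal hdim hdimA hs hsA htf hgI hgnzd hfam hum hg'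
    exact ⟨h.nonempty_quotient_equiv, h⟩
  · have h := sameOrbit_one_zero_of_projective hdim hdimA hs hsA htf hgI hgnzd hfam hum
    exact ⟨h.nonempty_quotient_equiv, h⟩
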